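/- Let G be a Cohen-Macaulay very well-covered graph and let w : E(G) → Z_{>0} be an edge weight on G. Then the following conditions are equivalent: (1) the edge-weighted edge ideal I(G_w) is an unmixed ideal; (2) S/I(G_w) is a Cohen-Macaulay ring. -/

import Mathlib

universe u

/-- An independent set in a graph. -/
def IsIndepSet {V : Type*} (G : SimpleGraph V) (A : Set V) : Prop :=
  A.Pairwise fun u v => ¬ G.Adj u v

/-- A maximal independent set in a graph. -/
def IsMaxIndepSet {V : Type*} (G : SimpleGraph V) (A : Set V) : Prop :=
  IsIndepSet G A ∧ ∀ B, IsIndepSet G B → A ⊆ B → A = B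

/-- A vertex cover of a graph. -/
def IsVertexCover {V : Type*} (G : SimpleGraph V) (C : Set V) : Prop :=
  ∀ ⦃u v⦄, G.Adj u v → u ∈ C ∨ v ∈ C

/-- A minimal vertex cover of a graph. -/
def IsMinVertexCover {V : Type*} (G : SimpleGraph V) (C : Set V) : Prop :=
  IsVertexCover G C ∧ ∀ B ⊆ C, IsVertexCover G B → B = C

/-- A graph has no isolated vertices. -/
def HasNoIsolatedVertices {V : Type*} (G : SimpleGraph V) : Prop :=
  ∀ v, ∃ u, G.Adj v u

/-- A graph is very well-covered if it has no isolated vertices, an even number of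
vertices, and every maximal independent set has cardinality half the number of vertices. -/
def IsVeryWellCovered {V : Type*} [Fintype V] (G : SimpleGraph V) : Prop :=
  HasNoIsolatedVertices G ∧ Even (Fintype.card V) ∧
    ∀ A : Set V, IsMaxIndepSet G A → A.ncard = Fintype.card V / 2

/-- Condition (*) for a graph on the `2h` vertices `x_1, …, x_h, y_1, …, y_h`
(encoded as `Sum.inl 0, …, Sum.inl (h-1), Sum.inr 0, …, Sum.inr (h-1)`):
`X = {x_1, …, x_h}` is a minimal vertex cover, `Y = {y_1, …, y_h}` is a maximal
independent set, and `x_i y_i` is an edge for every `i`. -/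
def CondStar {h : ℕ} (G : SimpleGraph (Fin h ⊕ Fin h)) : Prop :=
  IsMinVertexCover G (Set.range Sum.inl) ∧
    IsMaxIndepSet G (Set.range Sum.inr) ∧
    ∀ i : Fin h, G.Adj (Sum.inl i) (Sum.inr i)

/-- The height of an ideal `p` (intended: a prime ideal), i.e. the Krull dimension of the
set of prime ideals contained in `p`. -/
noncomputable def idealHeight {R : Type*} [CommRing R] (p : Ideal R) : WithBot ℕ∞ :=
  Order.krullDim {q : PrimeSpectrum R // q.asIdeal ≤ p}

/-- An ideal `I ⊆ R` is unmixed if all associated primes of `R ⧸ I` have the same height. -/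
def IsUnmixedIdeal {R : Type*} [CommRing R] (I : Ideal R) : Prop :=
  ∀ p ∈ associatedPrimes R (R ⧸ I), ∀ q ∈ associatedPrimes R (R ⧸ I),
    idealHeight p = idealHeight q

/-- The monomial associated to a weighted edge: `(X u * X v) ^ w(e)` for `e = uv`. -/
noncomputable def edgeMonomial {V : Type*} (K : Type*) [CommSemiring K]
    (w : Sym2 V → ℕ) (e : Sym2 V) : MvPolynomial V K :=
  (Sym2.lift ⟨fun u v => MvPolynomial.X u * MvPolynomial.X v,
    fun u v => mul_comm _ _⟩ e) ^ w e

/-- The edge-weighted edge ideal `I(G_w)` of an edge-weighted graph `G_w`. -/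
noncomputable def weightedEdgeIdeal {V : Type*} (K : Type*) [CommSemiring K]
    (G : SimpleGraph V) (w : Sym2 V → ℕ) : Ideal (MvPolynomial V K) :=
  Ideal.span (edgeMonomial K w '' G.edgeSet)

open CategoryTheory in
/-- The Ext module `Ext_R^n(M, N)`. -/
noncomputable def ExtMod (R : Type u) [CommRing R] (n : ℕ) (M N : Type u)
    [AddCommGroup M] [Module R M] [AddCommGroup N] [Module R N] : ModuleCat R :=
  ((Ext R (ModuleCat R) n).obj (Opposite.op (ModuleCat.of R M))).obj (ModuleCat.of R N)

/-- The depth of a local ring `R`, defined via vanishing of the Ext modules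
`Ext_R^n(k, R)`, where `k` is the residue field of `R`. -/
noncomputable def localRingDepth (R : Type u) [CommRing R] [IsLocalRing R] : ℕ∞ :=
  sInf {n : ℕ∞ | ∃ m : ℕ, n = m ∧
    Nontrivial (ExtMod R m (IsLocalRing.ResidueField R) R)}

/-- A commutative ring is Cohen-Macaulay if for every maximal ideal `p`, the depth of the
localization at `p` equals its Krull dimension. -/
def IsCohenMacaulayRing (R : Type u) [CommRing R] : Prop :=
  ∀ (p : Ideal R) [p.IsMaximal],
    (localRingDepth (Localization.AtPrime p) : WithBot ℕ∞) =
      ringKrullDim (Localization.AtPrime p)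

/-- The (unweighted) edge ideal `I(G)` of a graph, generated by the monomials `X u * X v`
for the edges `uv` of `G`. -/
noncomputable def edgeIdeal {V : Type*} (K : Type*) [CommSemiring K]
    (G : SimpleGraph V) : Ideal (MvPolynomial V K) :=
  Ideal.span ((fun e => Sym2.lift ⟨fun u v => MvPolynomial.X u * MvPolynomial.X v,
    fun u v => mul_comm _ _⟩ e) '' G.edgeSet)

section ExtBridge
open CategoryTheory Limits

theorem subsingleton_extMod_iff_homology {R : Type u} [CommRing R] (n : ℕ) (M N : Type u)
    [AddCommGroup M] [Module R M] [AddCommGroup N] [Module R N]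
    (P : ProjectiveResolution (ModuleCat.of R M)) :
    Subsingleton (ExtMod R n M N) ↔
      (P.complex.linearYonedaObj R (ModuleCat.of R N)).ExactAt n := by
  rw [HomologicalComplex.exactAt_iff_isZero_homology,
    ← (P.isoExt (R := R) n (ModuleCat.of R N)).isZero_iff, ← ModuleCat.isZero_iff_subsingleton]
  rfl

theorem exactAt_succ_iff {R : Type u} [CommRing R] (n : ℕ) (M N : Type u)
    [AddCommGroup M] [Module R M] [AddCommGroup N] [Module R N]
    (P : ProjectiveResolution (ModuleCat.of R M)) :
    (P.complex.linearYonedaObj R (ModuleCat.of R N)).ExactAt (n + 1) ↔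
      ∀ f : P.complex.X (n + 1) ⟶ ModuleCat.of R N, P.complex.d (n + 2) (n + 1) ≫ f = 0 →
        ∃ g : P.complex.X n ⟶ ModuleCat.of R N, P.complex.d (n + 1) n ≫ g = f := by
  rw [HomologicalComplex.exactAt_iff' _ n (n + 1) (n + 2) (by simp) (by simp),
    ShortComplex.moduleCat_exact_iff]
  rfl

theorem forall_hom_eq_zero_iff_of_exact {C : Type*} [Category* C] [Abelian C]
    {T : ShortComplex C} (hT : T.Exact) [Epi T.g] {N : C} :
    (∀ k : T.X₃ ⟶ N, k = 0) ↔ ∀ f : T.X₂ ⟶ N, T.f ≫ f = 0 → f = 0 := by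
  refine ⟨fun h f hf => ?_, fun h k => ?_⟩
  · rw [← hT.g_desc f hf, h (hT.desc f hf), comp_zero]
  · rw [← cancel_epi T.g, comp_zero]
    exact h _ (by simp)

theorem exactAt_zero_iff {R : Type u} [CommRing R] (M N : Type u)
    [AddCommGroup M] [Module R M] [AddCommGroup N] [Module R N]
    (P : ProjectiveResolution (ModuleCat.of R M)) :
    (P.complex.linearYonedaObj R (ModuleCat.of R N)).ExactAt 0 ↔
      ∀ f : P.complex.X 0 ⟶ ModuleCat.of R N, P.complex.d 1 0 ≫ f = 0 → f = 0 := by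
  rw [HomologicalComplex.exactAt_iff' _ 0 0 1 (by simp) (by simp),
    ShortComplex.moduleCat_exact_iff]
  refine forall_congr' fun f => forall_congr' fun _ => ⟨?_, ?_⟩
  · rintro ⟨x, hx⟩
    have h : (HomologicalComplex.sc' (P.complex.linearYonedaObj R (ModuleCat.of R N)) 0 0 1).f
      = 0 :=
      (P.complex.linearYonedaObj R (ModuleCat.of R N)).shape 0 0 (by simp)
    rw [h] at hx
    exact hx.symm
  · rintro h
    exact ⟨0, by rw [map_zero]; exact h.symm⟩

theorem subsingleton_extMod_iff {R : Type u} [CommRing R] (n : ℕ) (M N : Type u)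
    [AddCommGroup M] [Module R M] [AddCommGroup N] [Module R N] :
    Subsingleton (ExtMod R n M N) ↔
      Subsingleton (Abelian.Ext (ModuleCat.of R M) (ModuleCat.of R N) n) := by
  let P := projectiveResolution (ModuleCat.of R M)
  rw [subsingleton_extMod_iff_homology n M N P]
  cases n with
  | zero =>
    rw [exactAt_zero_iff, Abelian.Ext.addEquiv₀.subsingleton_congr]
    rw [← forall_hom_eq_zero_iff_of_exact P.exact₀]
    refine ⟨fun h => ⟨fun a b => ?_⟩, fun h f => ?_⟩
    · exact sub_eq_zero.1 (h (a - b))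
    · exact h.elim f 0
  | succ n =>
    rw [exactAt_succ_iff]
    constructor
    · intro h
      refine ⟨fun a b => ?_⟩
      rw [← sub_eq_zero]
      obtain ⟨f, hf, e⟩ := P.extMk_surjective (a - b) (n + 2) rfl
      rw [← e, P.extMk_eq_zero_iff f (n + 2) rfl hf n rfl]
      exact h f hf
    · intro h f hf
      exact (P.extMk_eq_zero_iff f (n + 2) rfl hf n rfl).1 (Subsingleton.elim _ _)

end ExtBridge

section Depth
open CategoryTheory Limits IsLocalRing RingTheory.Sequence Pointwise

variable {R : Type u} [CommRing R] [IsLocalRing R]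

theorem subsingleton_ext_of_lt_localRingDepth {n : ℕ} (h : (n : ℕ∞) < localRingDepth R) :
    Subsingleton (Abelian.Ext (ModuleCat.of R (ResidueField R)) (ModuleCat.of R R) n) := by
  rw [← subsingleton_extMod_iff, ← not_nontrivial_iff_subsingleton]
  exact fun hn => notMem_of_lt_csInf h (OrderBot.bddBelow _) ⟨n, rfl, hn⟩

theorem finite_residueField : Module.Finite R (ResidueField R) :=
  Module.Finite.of_surjective (Algebra.linearMap R (ResidueField R)) residue_surjective

theorem support_residueField :
    Module.support R (ResidueField R) = PrimeSpectrum.zeroLocus (maximalIdeal R) := by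
  have := finite_residueField (R := R)
  rw [Module.support_eq_zeroLocus]
  congr 2
  exact Ideal.annihilator_quotient

theorem maximalIdeal_smul_top_lt (M : Type*) [AddCommGroup M] [Module R M] [Module.Finite R M]
    [Nontrivial M] : maximalIdeal R • (⊤ : Submodule R M) < ⊤ :=
  lt_top_iff_ne_top.2 fun h =>
    Submodule.top_ne_ideal_smul_of_le_jacobson_annihilator
      (le_trans (IsLocalRing.maximalIdeal_le_jacobson _) le_rfl) h.symm

theorem nontrivial_quotSMulTop {a : R} (ha : a ∈ maximalIdeal R) (M : Type*) [AddCommGroup M]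
    [Module R M] [Module.Finite R M] [Nontrivial M] : Nontrivial (QuotSMulTop a M) := by
  refine Submodule.Quotient.nontrivial_iff.2 (lt_of_le_of_lt ?_ (maximalIdeal_smul_top_lt M)).ne
  rw [← Submodule.ideal_span_singleton_smul]
  exact Submodule.smul_mono_left ((Ideal.span_singleton_le_iff_mem _).2 ha)

variable [IsNoetherianRing R]

theorem length_le_localRingDepth {rs : List R} (hrs : ∀ r ∈ rs, r ∈ maximalIdeal R)
    (h : IsRegular R rs) : (rs.length : ℕ∞) ≤ localRingDepth R := by
  refine le_sInf ?_
  rintro _ ⟨m, rfl, hm⟩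
  by_contra! hlt
  rw [Nat.cast_lt] at hlt
  rw [← not_subsingleton_iff_nontrivial, subsingleton_extMod_iff] at hm
  have := finite_residueField (R := R)
  exact hm (ModuleCat.subsingleton_ext_of_exists_isRegular (maximalIdeal R)
    (ModuleCat.of R (ResidueField R)) support_residueField.subset (ModuleCat.of R R)
    (maximalIdeal_smul_top_lt R) rs hrs h m hlt)

theorem exists_isRegular_of_le_localRingDepth {t : ℕ} (h : (t : ℕ∞) ≤ localRingDepth R) :
    ∃ rs : List R, rs.length = t ∧ (∀ r ∈ rs, r ∈ maximalIdeal R) ∧ IsRegular R rs := by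
  have := finite_residueField (R := R)
  refine ModuleCat.exists_isRegular_of_exists_subsingleton_ext (maximalIdeal R) t
    (ModuleCat.of R R) (maximalIdeal_smul_top_lt R) (ModuleCat.of R (ResidueField R))
    support_residueField fun i hi => subsingleton_ext_of_lt_localRingDepth
      (lt_of_lt_of_le (by exact_mod_cast hi) h)

theorem exists_isRegular_quotSMulTop {t : ℕ} (h : ((t + 1 : ℕ) : ℕ∞) ≤ localRingDepth R) {a : R}
    (ha : a ∈ maximalIdeal R) (hreg : IsSMulRegular R a) :
    ∃ rs : List R, rs.length = t ∧ (∀ r ∈ rs, r ∈ maximalIdeal R) ∧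
      IsRegular (QuotSMulTop a R) rs := by
  have := finite_residueField (R := R)
  have : Nontrivial (QuotSMulTop a R) := nontrivial_quotSMulTop ha R
  refine ModuleCat.exists_isRegular_of_exists_subsingleton_ext (maximalIdeal R) t
    (ModuleCat.of R (QuotSMulTop a R)) (maximalIdeal_smul_top_lt _)
    (ModuleCat.of R (ResidueField R)) support_residueField fun i hi => ?_
  have hsub : ∀ j ≤ t, Subsingleton
      (Abelian.Ext (ModuleCat.of R (ResidueField R)) (ModuleCat.of R R) j) := fun j hj =>
    subsingleton_ext_of_lt_localRingDepth
      (lt_of_lt_of_le (by exact_mod_cast Nat.lt_succ_of_le hj) h)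
  have zero1 := AddCommGrpCat.isZero_of_iff_subsingleton.mpr (hsub i hi.le)
  have zero2 := AddCommGrpCat.isZero_of_iff_subsingleton.mpr (hsub (i + 1) hi)
  have hreg' : IsSMulRegular (ModuleCat.of R R) a := hreg
  exact AddCommGrpCat.subsingleton_of_isZero <| ShortComplex.Exact.isZero_of_both_zeros
    ((Abelian.Ext.covariant_sequence_exact₃' _ hreg'.smulShortComplex_shortExact) i (i + 1) rfl)
    (zero1.eq_zero_of_src _) (zero2.eq_zero_of_tgt _)

theorem exists_notMem_smul_top {M : Type*} [AddCommGroup M] [Module R M] [Module.Finite R M]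
    {x : R} (hx : x ∈ maximalIdeal R) (hreg : IsSMulRegular M x) {p : Ideal R} {m : M} (hm : m ≠ 0)
    (hpm : ∀ r ∈ p, r • m = 0) : ∃ n : M, (∀ r ∈ p, r • n = 0) ∧ n ∉ x • (⊤ : Submodule R M) := by
  by_contra! hcon
  let N : Submodule R M :=
    { carrier := {n | ∀ r ∈ p, r • n = 0}
      zero_mem' := fun r _ => smul_zero r
      add_mem' := fun {a b} ha hb r hr => by rw [smul_add, ha r hr, hb r hr, add_zero]
      smul_mem' := fun c a ha r hr => by rw [smul_comm, ha r hr, smul_zero] }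
  have hN : N = ⊥ := by
    refine Submodule.eq_bot_of_le_smul_of_le_jacobson_bot (Ideal.span {x}) N
      (IsNoetherian.noetherian N) ?_ ?_
    · intro n hn
      obtain ⟨y, -, rfl⟩ := (Submodule.mem_smul_pointwise_iff_exists _ _ _).1 (hcon n hn)
      refine Submodule.smul_mem_smul (Ideal.mem_span_singleton_self x) fun r hr => hreg ?_
      change x • r • y = x • (0 : M)
      rw [smul_zero, smul_comm]
      exact hn r hr
    · rw [Ideal.span_singleton_le_iff_mem]
      exact IsLocalRing.maximalIdeal_le_jacobson _ hx
  exact hm ((Submodule.mem_bot R).1 (hN ▸ (hpm : m ∈ N)))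

theorem exists_ltSeries_of_isWeaklyRegular (rs : List R) : ∀ {M : Type u} [AddCommGroup M]
    [Module R M] [Module.Finite R M], (∀ r ∈ rs, r ∈ maximalIdeal R) → IsWeaklyRegular M rs →
    ∀ p ∈ associatedPrimes R M, ∃ c : LTSeries (PrimeSpectrum R),
      c.length = rs.length ∧ c.head.asIdeal = p := by
  induction rs with
  | nil =>
    intro M _ _ _ _ _ p hp
    exact ⟨RelSeries.singleton _ ⟨p, hp.isPrime⟩, rfl, rfl⟩
  | cons x rs ih =>
    intro M _ _ _ hrs hreg p hp
    rw [isWeaklyRegular_cons_iff] at hreg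
    have hpp : p.IsPrime := hp.isPrime
    obtain ⟨m, rfl⟩ := (isAssociatedPrime_iff.1 hp).2
    have hmem : ∀ r, r ∈ (⊥ : Submodule R M).colon {m} ↔ r • m = 0 := fun r => by
      simp [Submodule.mem_colon_singleton]
    have hm : m ≠ 0 := by
      rintro rfl
      exact hpp.ne_top ((Ideal.eq_top_iff_one _).2 ((hmem 1).2 (smul_zero _)))
    obtain ⟨n, hn, hnx⟩ := exists_notMem_smul_top (hrs x (by simp)) hreg.1 hm
      (p := (⊥ : Submodule R M).colon {m}) fun r hr => (hmem r).1 hr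
    obtain ⟨q, hq, hle⟩ := exists_le_isAssociatedPrime_of_isNoetherianRing R
      (Submodule.Quotient.mk n : QuotSMulTop x M)
      (fun h => hnx ((Submodule.Quotient.mk_eq_zero _).1 h))
    obtain ⟨c, hc, hcq⟩ := ih (fun r hr => hrs r (by simp [hr])) hreg.2 q hq
    have hlt : (⊥ : Submodule R M).colon {m} < q := by
      refine lt_of_le_not_ge ?_ ?_
      · intro r hr
        refine hle (Submodule.mem_colon_singleton.2 ?_)
        rw [Submodule.mem_bot, ← Submodule.Quotient.mk_smul, hn r hr, Submodule.Quotient.mk_zero]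
      · intro hge
        have hxq : x ∈ q := by
          refine hle (Submodule.mem_colon_singleton.2 ?_)
          rw [Submodule.mem_bot, ← Submodule.Quotient.mk_smul, Submodule.Quotient.mk_eq_zero]
          exact Submodule.smul_mem_pointwise_smul _ _ _ trivial
        refine hm (hreg.1 ?_)
        change x • m = x • (0 : M)
        rw [smul_zero]
        exact (hmem x).1 (hge hxq)
    have hlt' : (⟨_, hpp⟩ : PrimeSpectrum R) < c.head := by
      change (⊥ : Submodule R M).colon {m} < c.head.asIdeal
      rwa [hcq]
    exact ⟨c.cons ⟨_, hpp⟩ hlt', by simp [hc], by simp⟩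

end Depth

section Dimension
open MvPolynomial

variable {V : Type*} {K : Type*} [Field K]

/-- The ideal generated by the variables in `C`. -/
noncomputable def varsIdeal (K : Type*) [Field K] (C : Set V) : Ideal (MvPolynomial V K) :=
  Ideal.span (X '' C)

open Classical in
/-- The substitution that sends the variables in `C` to zero. -/
noncomputable def killVars (K : Type*) [Field K] (C : Set V) :
    MvPolynomial V K →ₐ[K] MvPolynomial V K :=
  aeval fun v => if v ∈ C then 0 else X v

theorem killVars_X_of_mem {C : Set V} {v : V} (h : v ∈ C) :
    killVars K C (X v) = 0 := by simp [killVars, h]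

theorem killVars_X_of_notMem {C : Set V} {v : V} (h : v ∉ C) :
    killVars K C (X v) = X v := by simp [killVars, h]

theorem X_mem_varsIdeal {C : Set V} {v : V} (h : v ∈ C) :
    (X v : MvPolynomial V K) ∈ varsIdeal K C :=
  Ideal.subset_span ⟨v, h, rfl⟩

theorem sub_killVars_mem (C : Set V) (f : MvPolynomial V K) :
    f - killVars K C f ∈ varsIdeal K C := by
  induction f using MvPolynomial.induction_on with
  | C a => simp [killVars]
  | add p q hp hq =>
    rw [map_add, add_sub_add_comm]
    exact Ideal.add_mem _ hp hq
  | mul_X p v hp =>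
    have : p * X v - killVars K C (p * X v) = (p - killVars K C p) * X v +
        killVars K C p * (X v - killVars K C (X v)) := by rw [map_mul]; ring
    rw [this]
    refine Ideal.add_mem _ (Ideal.mul_mem_right _ _ hp) (Ideal.mul_mem_left _ _ ?_)
    by_cases hv : v ∈ C
    · rw [killVars_X_of_mem hv, sub_zero]
      exact X_mem_varsIdeal hv
    · rw [killVars_X_of_notMem hv, sub_self]
      exact Ideal.zero_mem _

theorem mem_varsIdeal_iff {C : Set V} {f : MvPolynomial V K} :
    f ∈ varsIdeal K C ↔ killVars K C f = 0 := by
  constructor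
  · intro h
    have : varsIdeal K C ≤ RingHom.ker (killVars K C) := by
      rw [varsIdeal, Ideal.span_le]
      rintro _ ⟨v, hv, rfl⟩
      exact killVars_X_of_mem hv
    exact this h
  · intro h
    have := sub_killVars_mem C f
    rwa [h, sub_zero] at this

theorem X_mem_varsIdeal_iff {C : Set V} {v : V} :
    (X v : MvPolynomial V K) ∈ varsIdeal K C ↔ v ∈ C := by
  refine ⟨fun h => ?_, X_mem_varsIdeal⟩
  by_contra hv
  rw [mem_varsIdeal_iff, killVars_X_of_notMem hv] at h
  exact X_ne_zero v h

theorem isPrime_varsIdeal (C : Set V) : (varsIdeal K C).IsPrime := by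
  have : varsIdeal K C = RingHom.ker (killVars K C) := by
    ext f
    exact mem_varsIdeal_iff
  rw [this]
  exact RingHom.ker_isPrime _

theorem varsIdeal_le_iff {C : Set V} {Q : Ideal (MvPolynomial V K)} :
    varsIdeal K C ≤ Q ↔ ∀ v ∈ C, (X v : MvPolynomial V K) ∈ Q := by
  rw [varsIdeal, Ideal.span_le, Set.image_subset_iff]
  rfl

theorem card_le_height_varsIdeal (T : Finset V) :
    (T.card : ℕ∞) ≤ (varsIdeal K (T : Set V)).height := by
  classical
  induction T using Finset.induction_on with
  | empty => simp
  | insert a T ha ih =>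
    rw [Finset.card_insert_of_notMem ha, Nat.cast_add, Nat.cast_one]
    have := isPrime_varsIdeal (K := K) (T : Set V)
    have := isPrime_varsIdeal (K := K) ((insert a T : Finset V) : Set V)
    refine le_trans (add_le_add_left ih 1) (Ideal.height_add_one_le_of_lt_of_isPrime ?_)
    refine lt_of_le_of_ne ?_ fun h => ?_
    · exact varsIdeal_le_iff.2 fun v hv => X_mem_varsIdeal (by simp [Finset.mem_coe.1 hv])
    · have h2 : (X a : MvPolynomial V K) ∈ varsIdeal K ((insert a T : Finset V) : Set V) :=
        X_mem_varsIdeal (by simp)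
      rw [← h, X_mem_varsIdeal_iff] at h2
      exact ha h2

theorem card_le_height (T : Finset V) (Q : Ideal (MvPolynomial V K))
    (h : ∀ v ∈ T, (X v : MvPolynomial V K) ∈ Q) : (T.card : ℕ∞) ≤ Q.height :=
  (card_le_height_varsIdeal T).trans (Ideal.height_mono (varsIdeal_le_iff.2 h))

theorem height_fin (n : ℕ) : ∀ (m : Ideal (MvPolynomial (Fin n) K)) [m.IsMaximal],
    m.height = n := by
  induction n with
  | zero =>
    intro m _
    have hm : m = ⊥ := by
      have e := (MvPolynomial.isEmptyRingEquiv K (Fin 0))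
      have hf : IsField (MvPolynomial (Fin 0) K) := e.toMulEquiv.isField (Field.toIsField K)
      let := hf.toField
      exact (Ideal.eq_bot_or_top m).resolve_right (Ideal.IsMaximal.ne_top ‹_›)
    simp [hm]
  | succ n ih =>
    intro m _
    let e := (MvPolynomial.finSuccEquiv K n).toRingEquiv
    have hmax : (m.map e).IsMaximal := Ideal.map_isMaximal_of_equiv e
    let p := (m.map e).comap Polynomial.C
    have hp : p.IsMaximal := Polynomial.isMaximal_comap_C_of_isJacobsonRing _
    have : (m.map e).LiesOver p := ⟨rfl⟩
    rw [← RingEquiv.height_map e m, Polynomial.height_eq_height_add_one p (m.map e), ih p]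
    simp

theorem height_of_isMaximal [Fintype V] (m : Ideal (MvPolynomial V K)) [m.IsMaximal] :
    m.height = Fintype.card V := by
  let e := (renameEquiv K (Fintype.equivFin V)).toRingEquiv
  have hmax : (m.map e).IsMaximal := Ideal.map_isMaximal_of_equiv e
  rw [← RingEquiv.height_map e m, height_fin]

theorem height_head_add_length_le {α : Type*} [Preorder α] (c : LTSeries α) :
    Order.height c.head + c.length ≤ Order.height c.last := by
  induction c using RelSeries.inductionOn with
  | singleton x => simp
  | cons p x hx ih =>
    refine le_trans ?_ (by simpa using ih)
    rw [RelSeries.head_cons, RelSeries.cons_length, Nat.cast_add, Nat.cast_one, add_comm _ (1 : ℕ∞),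
      ← add_assoc]
    gcongr
    exact Order.height_add_one_le hx

theorem height_comap_head_add_length_le {A B : Type*} [CommRing A] [CommRing B] (f : A →+* B)
    (hf : Function.Injective (PrimeSpectrum.comap f)) (c : LTSeries (PrimeSpectrum B)) :
    (c.head.asIdeal.comap f).height + c.length ≤ (c.last.asIdeal.comap f).height := by
  have hmono : StrictMono (PrimeSpectrum.comap f) :=
    Monotone.strictMono_of_injective (fun p q h => Ideal.comap_mono h) hf
  have := height_head_add_length_le (c.map _ hmono)
  rw [LTSeries.head_map, LTSeries.last_map] at this
  rw [← PrimeSpectrum.height_eq_orderHeight, ← PrimeSpectrum.height_eq_orderHeight] at this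
  exact this

theorem height_le_height_comap {A B : Type*} [CommRing A] [CommRing B] (f : A →+* B)
    (hf : Function.Surjective f) (q : Ideal B) [hq : q.IsPrime] :
    q.height ≤ (q.comap f).height := by
  have hmono : StrictMono (PrimeSpectrum.comap f) :=
    Monotone.strictMono_of_injective (fun p q h => Ideal.comap_mono h)
      (PrimeSpectrum.comap_injective_of_surjective f hf)
  have := Order.height_le_height_apply_of_strictMono _ hmono (⟨q, hq⟩ : PrimeSpectrum B)
  rw [← PrimeSpectrum.height_eq_orderHeight, ← PrimeSpectrum.height_eq_orderHeight] at this
  exact this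

end Dimension

section LocalAtMaximal
open MvPolynomial

section General
variable {S : Type*} [CommRing S] (L : Ideal S) (p : Ideal (S ⧸ L))

/-- The canonical map from a ring to a localization of one of its quotients. -/
noncomputable def toLocalQuotient [p.IsPrime] : S →+* Localization.AtPrime p :=
  (algebraMap (S ⧸ L) (Localization.AtPrime p)).comp (Ideal.Quotient.mk L)

/-- The preimage in the ambient ring of an ideal of a quotient. -/
def preimageIdeal : Ideal S := p.comap (Ideal.Quotient.mk L)

theorem le_preimageIdeal : L ≤ preimageIdeal L p := fun x hx => by
  rw [preimageIdeal, Ideal.mem_comap, Ideal.Quotient.eq_zero_iff_mem.2 hx]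
  exact Ideal.zero_mem _

instance isPrime_preimageIdeal [p.IsPrime] : (preimageIdeal L p).IsPrime :=
  Ideal.IsPrime.comap _

instance isMaximal_preimageIdeal [p.IsMaximal] : (preimageIdeal L p).IsMaximal :=
  Ideal.comap_isMaximal_of_surjective _ Ideal.Quotient.mk_surjective

variable [p.IsPrime]

theorem comap_toLocalQuotient_injective :
    Function.Injective (PrimeSpectrum.comap (toLocalQuotient L p)) := by
  rw [toLocalQuotient, PrimeSpectrum.comap_comp]
  exact (PrimeSpectrum.comap_injective_of_surjective _ Ideal.Quotient.mk_surjective).comp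
    (PrimeSpectrum.localization_comap_injective _ p.primeCompl)

theorem isUnit_toLocalQuotient_iff {f : S} :
    IsUnit (toLocalQuotient L p f) ↔ f ∉ preimageIdeal L p :=
  IsLocalization.AtPrime.isUnit_to_map_iff _ p _

theorem toLocalQuotient_mem_maximalIdeal_iff {f : S} :
    toLocalQuotient L p f ∈ IsLocalRing.maximalIdeal (Localization.AtPrime p) ↔
      f ∈ preimageIdeal L p :=
  IsLocalization.AtPrime.to_map_mem_maximal_iff _ p _

theorem toLocalQuotient_eq_zero_of_mem {f : S} (h : f ∈ L) : toLocalQuotient L p f = 0 := by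
  rw [toLocalQuotient, RingHom.comp_apply, Ideal.Quotient.eq_zero_iff_mem.2 h, map_zero]

theorem exists_mul_toLocalQuotient_eq (r : Localization.AtPrime p) :
    ∃ f s : S, s ∉ preimageIdeal L p ∧ r * toLocalQuotient L p s = toLocalQuotient L p f := by
  obtain ⟨⟨a, s⟩, h⟩ := IsLocalization.surj p.primeCompl r
  obtain ⟨f, rfl⟩ := Ideal.Quotient.mk_surjective a
  obtain ⟨t, ht⟩ := Ideal.Quotient.mk_surjective (s : S ⧸ L)
  refine ⟨f, t, fun hts => s.2 ?_, ?_⟩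
  · rw [← ht]; exact hts
  · rw [toLocalQuotient, RingHom.comp_apply, RingHom.comp_apply, ht]; exact h

theorem toLocalQuotient_mem_map_iff {J : Ideal S} {g : S} :
    toLocalQuotient L p g ∈ J.map (toLocalQuotient L p) ↔
      ∃ s, s ∉ preimageIdeal L p ∧ s * g ∈ L ⊔ J := by
  rw [toLocalQuotient, ← Ideal.map_map, RingHom.comp_apply,
    IsLocalization.algebraMap_mem_map_algebraMap_iff p.primeCompl]
  have key : ∀ x, Ideal.Quotient.mk L x ∈ J.map (Ideal.Quotient.mk L) ↔ x ∈ L ⊔ J := by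
    intro x
    rw [sup_comm, ← Ideal.mem_quotient_iff_mem_sup]
  constructor
  · rintro ⟨m, hm, h⟩
    obtain ⟨t, rfl⟩ := Ideal.Quotient.mk_surjective m
    exact ⟨t, hm, (key _).1 (by rwa [map_mul])⟩
  · rintro ⟨s, hs, h⟩
    exact ⟨_, hs, by rw [← map_mul]; exact (key _).2 h⟩

theorem toLocalQuotient_eq_zero_iff {g : S} :
    toLocalQuotient L p g = 0 ↔ ∃ s, s ∉ preimageIdeal L p ∧ s * g ∈ L := by
  have := toLocalQuotient_mem_map_iff L p (J := ⊥) (g := g)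
  rwa [Ideal.map_bot, Ideal.mem_bot, sup_bot_eq] at this

theorem le_comap_toLocalQuotient (q : Ideal (Localization.AtPrime p)) :
    L ≤ q.comap (toLocalQuotient L p) := fun f hf => by
  rw [Ideal.mem_comap, toLocalQuotient_eq_zero_of_mem L p hf]
  exact Ideal.zero_mem _

end General

section Abstract
open IsLocalRing RingTheory.Sequence
variable {S : Type u} [CommRing S] (L : Ideal S) {n : ℕ}

theorem height_comap_head_add_length_le_of_forall
    (hn : ∀ m : Ideal S, m.IsMaximal → m.height ≤ n) (p : Ideal (S ⧸ L)) [p.IsPrime]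
    (c : LTSeries (PrimeSpectrum (Localization.AtPrime p))) :
    (c.head.asIdeal.comap (toLocalQuotient L p)).height + c.length ≤ n := by
  refine (height_comap_head_add_length_le _ (comap_toLocalQuotient_injective L p) c).trans ?_
  obtain ⟨m, hm, hle⟩ := Ideal.exists_le_maximal (c.last.asIdeal.comap (toLocalQuotient L p))
    (Ideal.IsPrime.ne_top inferInstance)
  exact (Ideal.height_mono hle).trans (hn m hm)

variable [IsNoetherianRing S]

theorem height_comap_add_length_le (hn : ∀ m : Ideal S, m.IsMaximal → m.height ≤ n)
    (p : Ideal (S ⧸ L)) [p.IsPrime] {M : Type u} [AddCommGroup M]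
    [Module (Localization.AtPrime p) M] [Module.Finite (Localization.AtPrime p) M]
    {rs : List (Localization.AtPrime p)} (hrs : ∀ r ∈ rs, r ∈ maximalIdeal (Localization.AtPrime p))
    (hreg : IsWeaklyRegular M rs) {q : Ideal (Localization.AtPrime p)}
    (hq : q ∈ associatedPrimes (Localization.AtPrime p) M) :
    (q.comap (toLocalQuotient L p)).height + rs.length ≤ n := by
  have : IsNoetherianRing (Localization.AtPrime p) :=
    IsLocalization.isNoetherianRing p.primeCompl _ inferInstance
  obtain ⟨c, hc, rfl⟩ := exists_ltSeries_of_isWeaklyRegular rs hrs hreg q hq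
  rw [← hc]
  exact height_comap_head_add_length_le_of_forall L hn p c

theorem isCohenMacaulayRing_quotient {h t : ℕ} (hn : ∀ m : Ideal S, m.IsMaximal → m.height ≤ n)
    (hL : ∀ Q : Ideal S, Q.IsPrime → L ≤ Q → (h : ℕ∞) ≤ Q.height) (hht : n ≤ h + t)
    (hreg : ∀ (p : Ideal (S ⧸ L)) [p.IsMaximal], ∃ rs : List (Localization.AtPrime p),
      rs.length = t ∧ (∀ r ∈ rs, r ∈ maximalIdeal (Localization.AtPrime p)) ∧
      IsWeaklyRegular (Localization.AtPrime p) rs) :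
    IsCohenMacaulayRing (S ⧸ L) := by
  intro p _
  have : IsNoetherianRing (Localization.AtPrime p) :=
    IsLocalization.isNoetherianRing p.primeCompl _ inferInstance
  obtain ⟨rs, hlen, hrs, hr⟩ := hreg p
  have hdim : ringKrullDim (Localization.AtPrime p) ≤ t := by
    refine iSup_le fun c => ?_
    have h1 := height_comap_head_add_length_le_of_forall L hn p c
    have h2 := hL (c.head.asIdeal.comap (toLocalQuotient L p)) inferInstance
      (le_comap_toLocalQuotient L p _)
    have h3 : ((h + c.length : ℕ) : ℕ∞) ≤ n := by
      rw [Nat.cast_add]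
      exact (add_le_add_left h2 _).trans h1
    have h4 : h + c.length ≤ n := by exact_mod_cast h3
    have h5 : c.length ≤ t := by omega
    exact_mod_cast h5
  have hreg' := (IsLocalRing.isRegular_iff_isWeaklyRegular_of_subset_maximalIdeal hrs).2 hr
  have hle := length_le_localRingDepth hrs hreg'
  rw [hlen] at hle
  have hge : localRingDepth (Localization.AtPrime p) ≤ t := by
    refine ENat.forall_natCast_le_iff_le.1 fun s hs => ?_
    obtain ⟨rs', hlen', hrs', hr'⟩ := exists_isRegular_of_le_localRingDepth hs
    obtain ⟨q, hq⟩ := associatedPrimes.nonempty (Localization.AtPrime p) (Localization.AtPrime p)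
    obtain ⟨c, hc, -⟩ := exists_ltSeries_of_isWeaklyRegular rs' hrs' hr'.1 q hq
    have h6 : (c.length : WithBot ℕ∞) ≤ t := (le_iSup_of_le c le_rfl).trans hdim
    rw [hc, hlen'] at h6
    exact_mod_cast h6
  have heq := le_antisymm hge hle
  rw [heq]
  refine le_antisymm ?_ hdim
  obtain ⟨q, hq⟩ := associatedPrimes.nonempty (Localization.AtPrime p) (Localization.AtPrime p)
  obtain ⟨c, hc, -⟩ := exists_ltSeries_of_isWeaklyRegular rs hrs hr q hq
  rw [← hlen, ← hc]
  exact le_iSup_of_le c le_rfl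

omit [IsNoetherianRing S] in
theorem le_localRingDepth_of_isCohenMacaulayRing (hCM : IsCohenMacaulayRing (S ⧸ L))
    (p : Ideal (S ⧸ L)) [p.IsMaximal] {t : ℕ} (ht : (t : ℕ∞) ≤ p.height) :
    (t : ℕ∞) ≤ localRingDepth (Localization.AtPrime p) := by
  have h1 := hCM p
  rw [IsLocalization.AtPrime.ringKrullDim_eq_height p] at h1
  have : localRingDepth (Localization.AtPrime p) = p.height := by exact_mod_cast h1
  rwa [this]

end Abstract

variable {V : Type*} [Fintype V] {K : Type*} [Field K]
  (L : Ideal (MvPolynomial V K)) (p : Ideal (MvPolynomial V K ⧸ L))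

theorem card_le_card_add_height [p.IsMaximal] (C : Finset V)
    (hC : ∀ v ∈ C, X v ∈ preimageIdeal L p) (hL : L ≤ varsIdeal K (C : Set V)) :
    (Fintype.card V : ℕ∞) ≤ p.height + C.card := by
  classical
  have hCm : varsIdeal K (C : Set V) ≤ preimageIdeal L p := varsIdeal_le_iff.2 hC
  rw [← height_of_isMaximal (preimageIdeal L p)]
  have hs : (X '' (C : Set V) : Set (MvPolynomial V K)) ⊆ preimageIdeal L p := by
    rintro _ ⟨v, hv, rfl⟩
    exact hC v hv
  refine (Ideal.height_le_height_add_encard_of_subset _ hs).trans ?_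
  have hp' := Ideal.isPrime_map_quotientMk_of_isPrime hCm
  refine add_le_add ?_ ?_
  · refine (height_le_height_comap (Ideal.Quotient.factor hL)
      (Ideal.Quotient.factor_surjective hL) ((preimageIdeal L p).map
        (Ideal.Quotient.mk (varsIdeal K (C : Set V))))).trans (Ideal.height_mono ?_)
    intro x hx
    obtain ⟨x, rfl⟩ := Ideal.Quotient.mk_surjective x
    rw [Ideal.mem_comap, Ideal.Quotient.factor_mk, Ideal.mem_quotient_iff_mem hCm] at hx
    exact hx
  · refine (Set.encard_image_le _ _).trans ?_
    rw [Set.encard_coe_eq_coe_finsetCard]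

end LocalAtMaximal

section Unmixed
open IsLocalRing RingTheory.Sequence

theorem idealHeight_eq_height {R : Type*} [CommRing R] (p : Ideal R) [hp : p.IsPrime] :
    idealHeight p = p.height := by
  have := Order.height_eq_krullDim_Iic (⟨p, hp⟩ : PrimeSpectrum R)
  rw [← PrimeSpectrum.height_eq_orderHeight] at this
  exact this.symm

variable {S : Type u} [CommRing S] [IsNoetherianRing S] (L : Ideal S) {n : ℕ}

theorem exists_mul_mem_iff_of_mem_associatedPrimes {p : Ideal S}
    (hp : p ∈ associatedPrimes S (S ⧸ L)) : ∃ g : S, ∀ s, s ∈ p ↔ s * g ∈ L := by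
  obtain ⟨x, rfl⟩ := (isAssociatedPrime_iff.1 hp).2
  obtain ⟨g, rfl⟩ := Ideal.Quotient.mk_surjective x
  refine ⟨g, fun s => ?_⟩
  rw [Submodule.mem_colon_singleton, Submodule.mem_bot, ← Ideal.Quotient.eq_zero_iff_mem, map_mul,
    Algebra.smul_def]
  rfl

theorem exists_associatedPrime_of_notMem {g : S} (hg : g ∉ L) :
    ∃ p ∈ associatedPrimes S (S ⧸ L), ∀ s, s * g ∈ L → s ∈ p := by
  obtain ⟨p, hp, hle⟩ := exists_le_isAssociatedPrime_of_isNoetherianRing S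
    (Ideal.Quotient.mk L g) (fun h => hg (Ideal.Quotient.eq_zero_iff_mem.1 h))
  refine ⟨p, hp, fun s hs => hle ?_⟩
  rw [Submodule.mem_colon_singleton, Submodule.mem_bot, Algebra.smul_def]
  exact (map_mul (Ideal.Quotient.mk L) s g).symm.trans (Ideal.Quotient.eq_zero_iff_mem.2 hs)

omit [IsNoetherianRing S] in
theorem exists_preimageIdeal_eq {m : Ideal S} (hm : m.IsMaximal) (hLm : L ≤ m) :
    ∃ p : Ideal (S ⧸ L), p.IsMaximal ∧ preimageIdeal L p = m := by
  have hP : preimageIdeal L (m.map (Ideal.Quotient.mk L)) = m := by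
    ext x
    rw [preimageIdeal, Ideal.mem_comap]
    exact Ideal.mem_quotient_iff_mem hLm
  refine ⟨_, (Ideal.map_eq_top_or_isMaximal_of_surjective _ Ideal.Quotient.mk_surjective
    hm).resolve_left fun htop => hm.ne_top ?_, hP⟩
  rw [← hP, preimageIdeal, htop, Ideal.comap_top]

theorem isUnmixedIdeal_of_isCohenMacaulayRing {h t : ℕ}
    (hn : ∀ m : Ideal S, m.IsMaximal → m.height ≤ n)
    (hL : ∀ Q : Ideal S, Q.IsPrime → L ≤ Q → (h : ℕ∞) ≤ Q.height) (hht : n ≤ h + t)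
    (ht : ∀ (p : Ideal (S ⧸ L)) [p.IsMaximal], (t : ℕ∞) ≤ p.height)
    (hCM : IsCohenMacaulayRing (S ⧸ L)) : IsUnmixedIdeal L := by
  suffices key : ∀ p ∈ associatedPrimes S (S ⧸ L), idealHeight p = (h : ℕ∞) by
    intro p hp q hq
    rw [key p hp, key q hq]
  intro p hp
  have hpp : p.IsPrime := hp.isPrime
  rw [idealHeight_eq_height]
  obtain ⟨g, hg⟩ := exists_mul_mem_iff_of_mem_associatedPrimes L hp
  have hLp : L ≤ p := fun s hs => (hg s).2 (Ideal.mul_mem_right _ _ hs)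
  obtain ⟨m, hm, hpm⟩ := Ideal.exists_le_maximal p hpp.ne_top
  obtain ⟨P, hmax, hP⟩ := exists_preimageIdeal_eq L hm (hLp.trans hpm)
  have : IsNoetherianRing (Localization.AtPrime P) :=
    IsLocalization.isNoetherianRing P.primeCompl _ inferInstance
  have hne : toLocalQuotient L P g ≠ 0 := by
    rw [Ne, toLocalQuotient_eq_zero_iff]
    rintro ⟨s, hs, hsg⟩
    rw [hP] at hs
    exact hs (hpm ((hg s).2 hsg))
  obtain ⟨q, hq, hle⟩ := exists_le_isAssociatedPrime_of_isNoetherianRing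
    (Localization.AtPrime P) _ hne
  obtain ⟨rs, hlen, hrs, hr⟩ := exists_isRegular_of_le_localRingDepth
    (le_localRingDepth_of_isCohenMacaulayRing L hCM P (ht P))
  have h1 := height_comap_add_length_le L hn P hrs hr.1 hq
  have h2 : p ≤ q.comap (toLocalQuotient L P) := by
    intro s hs
    refine hle ?_
    rw [Submodule.mem_colon_singleton, Submodule.mem_bot, smul_eq_mul, ← map_mul]
    exact toLocalQuotient_eq_zero_of_mem L P ((hg s).1 hs)
  have h3 : p.height + t ≤ (h : ℕ∞) + t := by
    refine (add_le_add_left (Ideal.height_mono h2) _).trans ?_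
    rw [← hlen]
    refine h1.trans ?_
    rw [hlen]
    exact_mod_cast hht
  have h4 : p.height ≤ h := (ENat.add_le_add_iff_right (ENat.natCast_ne_top t)).1 h3
  exact_mod_cast le_antisymm h4 (hL p hpp hLp)

end Unmixed

section Graph

variable {V : Type*} {G : SimpleGraph V}

theorem exists_isMaxIndepSet [Finite V] {A : Set V} (hA : IsIndepSet G A) :
    ∃ B, A ⊆ B ∧ IsMaxIndepSet G B := by
  obtain ⟨B, hAB, hB⟩ := Finite.exists_le_maximal (p := IsIndepSet G) hA
  exact ⟨B, hAB, hB.1, fun C hC hBC => Set.Subset.antisymm hBC (hB.2 hC hBC)⟩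

theorem isIndepSet_pair {u v : V} (h : ¬ G.Adj u v) : IsIndepSet G {u, v} := by
  rintro a (rfl | rfl) b (rfl | rfl) hab
  · exact absurd rfl hab
  · exact h
  · exact fun h' => h h'.symm
  · exact absurd rfl hab

variable [Fintype V]

theorem IsVeryWellCovered.ncard_le (hG : IsVeryWellCovered G) {A : Set V} (hA : IsIndepSet G A) :
    A.ncard ≤ Fintype.card V / 2 := by
  obtain ⟨B, hAB, hB⟩ := exists_isMaxIndepSet hA
  rw [← hG.2.2 B hB]
  exact Set.ncard_le_ncard hAB

open Classical in
/-- The set of vertices adjacent to some vertex of a given finite set. -/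
noncomputable def neighbors (G : SimpleGraph V) (S : Finset V) : Finset V :=
  S.biUnion fun v => Finset.univ.filter (G.Adj v)

theorem mem_neighbors {S : Finset V} {u : V} : u ∈ neighbors G S ↔ ∃ v ∈ S, G.Adj v u := by
  simp [neighbors]

theorem IsVeryWellCovered.card_le_card_neighbors (hG : IsVeryWellCovered G) (S : Finset V)
    (hS : IsIndepSet G (S : Set V)) : S.card ≤ (neighbors G S).card := by
  classical
  induction S using Finset.strongInduction with
  | H S ih =>
    rcases S.eq_empty_or_nonempty with rfl | ⟨s, hs⟩
    · simp
    obtain ⟨u, hu⟩ := hG.1 s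
    obtain ⟨B', huB, hB⟩ := exists_isMaxIndepSet (G := G) (A := {u}) (Set.pairwise_singleton _ _)
    obtain ⟨B, rfl⟩ : ∃ B : Finset V, (B : Set V) = B' := ⟨_, B'.toFinite.coe_toFinset⟩
    have hBc := hG.2.2 _ hB
    rw [Set.ncard_coe_finset] at hBc
    have huB : u ∈ B := by simpa using huB
    set B0 := B ∩ neighbors G S with hB0
    set S0 := S ∩ neighbors G B0 with hS0
    have hu0 : u ∈ B0 := Finset.mem_inter.2 ⟨huB, mem_neighbors.2 ⟨s, hs, hu⟩⟩
    have hs0 : s ∈ S0 := Finset.mem_inter.2 ⟨hs, mem_neighbors.2 ⟨u, hu0, hu.symm⟩⟩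
    have hind : IsIndepSet G ((B \ B0 ∪ S0 : Finset V) : Set V) := by
      have hcross : ∀ a ∈ B \ B0, ∀ b ∈ S0, ¬ G.Adj b a := by
        intro a ha b hb hab
        rw [Finset.mem_sdiff] at ha
        exact ha.2 (Finset.mem_inter.2 ⟨ha.1, mem_neighbors.2 ⟨b, (Finset.mem_inter.1 hb).1, hab⟩⟩)
      intro a ha b hb hab
      rw [Finset.mem_coe, Finset.mem_union] at ha hb
      rcases ha with ha | ha <;> rcases hb with hb | hb
      · exact hB.1 (Finset.mem_sdiff.1 ha).1 (Finset.mem_sdiff.1 hb).1 hab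
      · exact fun h => hcross a ha b hb h.symm
      · exact hcross b hb a ha
      · exact hS (Finset.mem_inter.1 ha).1 (Finset.mem_inter.1 hb).1 hab
    have hdisj : Disjoint (B \ B0) S0 := by
      rw [Finset.disjoint_left]
      intro a ha hb
      obtain ⟨b, hb1, hb2⟩ := mem_neighbors.1 (Finset.mem_inter.1 hb).2
      exact hB.1 (Finset.mem_inter.1 hb1).1 (Finset.mem_sdiff.1 ha).1 hb2.ne hb2
    have h1 := hG.ncard_le hind
    rw [Set.ncard_coe_finset, Finset.card_union_of_disjoint hdisj,
      Finset.card_sdiff_of_subset Finset.inter_subset_left] at h1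
    have h2 : B0.card ≤ B.card := Finset.card_le_card Finset.inter_subset_left
    have h3 := ih (S \ S0) (Finset.sdiff_ssubset Finset.inter_subset_left ⟨s, hs0⟩)
      (hS.mono (by simp))
    have h4 : neighbors G (S \ S0) ⊆ neighbors G S \ B0 := by
      intro a ha
      obtain ⟨b, hb, hba⟩ := mem_neighbors.1 ha
      rw [Finset.mem_sdiff] at hb ⊢
      refine ⟨mem_neighbors.2 ⟨b, hb.1, hba⟩, fun ha0 => hb.2 ?_⟩
      exact Finset.mem_inter.2 ⟨hb.1, mem_neighbors.2 ⟨a, ha0, hba.symm⟩⟩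
    have h5 := Finset.card_le_card h4
    rw [Finset.card_sdiff_of_subset Finset.inter_subset_right] at h5
    have h6 : B0.card ≤ (neighbors G S).card := Finset.card_le_card Finset.inter_subset_right
    rw [Finset.card_sdiff_of_subset Finset.inter_subset_left] at h3
    have h7 : S0.card ≤ S.card := Finset.card_le_card Finset.inter_subset_left
    rw [← hB0] at h1 h5
    rw [← hS0] at h3
    omega

theorem IsVeryWellCovered.exists_matching (hG : IsVeryWellCovered G) :
    ∃ σ : V → V, Function.Involutive σ ∧ ∀ v, G.Adj v (σ v) := by
  classical
  obtain ⟨Y', -, hY⟩ := exists_isMaxIndepSet (G := G) (A := ∅) (Set.pairwise_empty _)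
  obtain ⟨Y, rfl⟩ : ∃ B : Finset V, (B : Set V) = Y' := ⟨_, Y'.toFinite.coe_toFinset⟩
  have hYc := hG.2.2 _ hY
  rw [Set.ncard_coe_finset] at hYc
  obtain ⟨k, hk⟩ := hG.2.1
  obtain ⟨f, hf, hfa⟩ := (Finset.all_card_le_biUnion_card_iff_exists_injective
    (fun y : Y => Finset.univ.filter (G.Adj y))).1 (by
      intro S
      have hsub : ((S.map (Function.Embedding.subtype _) : Finset V) : Set V) ⊆ Y := by
        intro a ha
        obtain ⟨b, -, rfl⟩ := Finset.mem_map.1 (Finset.mem_coe.1 ha)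
        exact b.2
      have := hG.card_le_card_neighbors (S.map (Function.Embedding.subtype _)) (hY.1.mono hsub)
      rw [Finset.card_map] at this
      refine this.trans (Finset.card_le_card ?_)
      intro a ha
      obtain ⟨b, hb, hba⟩ := mem_neighbors.1 ha
      obtain ⟨c, hc, rfl⟩ := Finset.mem_map.1 hb
      exact Finset.mem_biUnion.2 ⟨c, hc, by simpa using hba⟩)
  have hfa' : ∀ y : Y, G.Adj y (f y) := fun y => by simpa using hfa y
  have hfn : ∀ y : Y, f y ∉ Y := fun y hy => hY.1 y.2 hy (hfa' y).ne (hfa' y)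
  have hsurj : ∀ z, z ∉ Y → ∃ y, f y = z := by
    intro z hz
    have himg : Finset.univ.image f = Yᶜ := by
      refine Finset.eq_of_subset_of_card_le ?_ ?_
      · intro a ha
        obtain ⟨y, -, rfl⟩ := Finset.mem_image.1 ha
        simpa using hfn y
      · rw [Finset.card_image_of_injective _ hf, Finset.card_compl, Finset.card_univ,
          Fintype.card_coe]
        omega
    have : z ∈ Finset.univ.image f := by rw [himg]; simpa using hz
    obtain ⟨y, -, hy⟩ := Finset.mem_image.1 this
    exact ⟨y, hy⟩
  choose g hg using hsurj
  refine ⟨fun v => if h : v ∈ Y then f ⟨v, h⟩ else g v h, ?_, ?_⟩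
  · intro v
    by_cases h : v ∈ Y
    · simp only [h, dite_true, hfn, dite_false]
      have := hg (f ⟨v, h⟩) (hfn _)
      exact congrArg Subtype.val (hf this)
    · simp only [h, dite_false, (g v h).2, dite_true]
      exact hg v h
  · intro v
    by_cases h : v ∈ Y
    · simp only [h, dite_true]
      exact hfa' ⟨v, h⟩
    · simp only [h, dite_false]
      have := hfa' (g v h)
      rw [hg] at this
      exact this.symm

theorem matching_mem_of_notMem {σ : V → V} (hG : IsVeryWellCovered G)
    (hσ : Function.Involutive σ) (hadj : ∀ v, G.Adj v (σ v)) {B : Set V}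
    (hB : IsMaxIndepSet G B) {x : V} (hx : x ∉ B) : σ x ∈ B := by
  have hsub : σ '' B ⊆ Bᶜ := by
    rintro _ ⟨b, hb, rfl⟩ hb'
    exact hB.1 hb hb' (hadj b).ne (hadj b)
  have heq : σ '' B = Bᶜ := by
    refine Set.eq_of_subset_of_ncard_le hsub ?_
    rw [Set.ncard_image_of_injective _ hσ.injective, hG.2.2 B hB, Set.ncard_compl, hG.2.2 B hB,
      Nat.card_eq_fintype_card]
    obtain ⟨k, hk⟩ := hG.2.1
    omega
  have : x ∈ σ '' B := heq ▸ hx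
  obtain ⟨b, hb, rfl⟩ := this
  rwa [hσ b]

theorem ne_and_adj_of_adj_matching {σ : V → V} (hG : IsVeryWellCovered G)
    (hσ : Function.Involutive σ) (hadj : ∀ v, G.Adj v (σ v)) {u v x : V}
    (hu : G.Adj u x) (hv : G.Adj v (σ x)) : u ≠ v ∧ G.Adj u v := by
  have key : G.Adj u v := by
    by_contra h
    obtain ⟨B, hsub, hB⟩ := exists_isMaxIndepSet (isIndepSet_pair h)
    have huB : u ∈ B := hsub (by simp)
    have hvB : v ∈ B := hsub (by simp)
    refine hB.1 hvB (matching_mem_of_notMem hG hσ hadj hB (x := x) fun hx => ?_) hv.ne hv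
    exact hB.1 huB hx hu.ne hu
  exact ⟨key.ne, key⟩

/-- The vertices in a list together with their images under an involution. -/
def processed (σ : V → V) (l : List V) : Set V := {v | v ∈ l ∨ σ v ∈ l}

/-- A list such that the neighbors of every entry, except its partner, are processed by the
entries after it. -/
def IsLeafOrder (G : SimpleGraph V) (σ : V → V) : List V → Prop
  | [] => True
  | y :: l => IsLeafOrder G σ l ∧ y ∉ processed σ l ∧
      ∀ z, G.Adj y z → z = σ y ∨ z ∈ processed σ l

omit [Fintype V] in
theorem mem_processed_involutive {σ : V → V} (hσ : Function.Involutive σ) {l : List V} {v : V} :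
    σ v ∈ processed σ l ↔ v ∈ processed σ l := by
  simp only [processed, Set.mem_ofPred_eq, hσ v]
  exact or_comm

omit [Fintype V] in
theorem processed_cons {σ : V → V} (hσ : Function.Involutive σ) (y : V) (l : List V) :
    processed σ (y :: l) = insert y (insert (σ y) (processed σ l)) := by
  ext v
  simp only [processed, Set.mem_ofPred_eq, List.mem_cons, Set.mem_insert_iff]
  have : σ v = y ↔ v = σ y := ⟨fun h => by rw [← h, hσ v], fun h => by rw [h, hσ y]⟩
  tauto

theorem exists_isLeafOrder {σ : V → V} (hG : IsVeryWellCovered G) (hσ : Function.Involutive σ)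
    (hadj : ∀ v, G.Adj v (σ v)) (hno : ∀ x z, G.Adj x z → z ≠ σ x → ¬ G.Adj (σ x) (σ z)) :
    ∃ l, IsLeafOrder G σ l ∧ ∀ v, v ∈ processed σ l := by
  classical
  suffices key : ∀ (k : ℕ) (l : List V), IsLeafOrder G σ l →
      (Finset.univ.filter fun v => v ∉ processed σ l).card ≤ k →
      ∃ l, IsLeafOrder G σ l ∧ ∀ v, v ∈ processed σ l from key _ [] trivial le_rfl
  intro k
  induction k with
  | zero =>
    intro l hl hk
    refine ⟨l, hl, fun v => ?_⟩
    by_contra hv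
    have : v ∈ Finset.univ.filter fun v => v ∉ processed σ l := by simpa using hv
    rw [Finset.card_eq_zero.1 (Nat.le_zero.1 hk)] at this
    simp at this
  | succ k ih =>
    intro l hl hk
    rcases (Finset.univ.filter fun v => v ∉ processed σ l).eq_empty_or_nonempty with he | hne
    · exact ⟨l, hl, fun v => by
        by_contra hv
        have : v ∈ Finset.univ.filter fun v => v ∉ processed σ l := by simpa using hv
        rw [he] at this
        simp at this⟩
    obtain ⟨y, hy, hmin⟩ := Finset.exists_min_image _
      (fun v => (Finset.univ.filter (G.Adj v)).card) hne
    have hy' : y ∉ processed σ l := by simpa using hy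
    refine ih (y :: l) ⟨hl, hy', fun z hyz => ?_⟩ (Nat.lt_succ_iff.1 (lt_of_lt_of_le
      (Finset.card_lt_card ?_) hk))
    · by_contra! hz
      have hσz : σ z ∉ processed σ l := fun h => hz.2 ((mem_processed_involutive hσ).1 h)
      refine absurd (hmin (σ z) (by simpa using hσz)) (not_le.2 (Finset.card_lt_card ?_))
      refine Finset.ssubset_iff_subset_ne.2 ⟨fun u hu => ?_, fun he => ?_⟩
      · have hu' : G.Adj (σ z) u := by simpa using hu
        have := (ne_and_adj_of_adj_matching hG hσ hadj (u := u) (v := y) (x := σ z) hu'.symm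
          (by rwa [hσ z])).2
        simpa using this.symm
      · have hmem : σ y ∈ Finset.univ.filter (G.Adj y) := by simpa using hadj y
        rw [← he] at hmem
        exact hno y z hyz hz.1 (by simpa using hmem : G.Adj (σ z) (σ y)).symm
    · refine Finset.ssubset_iff_subset_ne.2 ⟨fun u hu => ?_, fun he => ?_⟩
      · rw [Finset.mem_filter, processed_cons hσ] at hu
        rw [Finset.mem_filter]
        exact ⟨hu.1, fun h => hu.2 (by simp [h])⟩
      · rw [← he, Finset.mem_filter, processed_cons hσ] at hy
        exact hy.2 (by simp)

theorem IsLeafOrder.card_processed {σ : V → V} (hσ : Function.Involutive σ)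
    (hne : ∀ v, v ≠ σ v) {l : List V} (hl : IsLeafOrder G σ l) :
    (processed σ l).ncard = 2 * l.length := by
  induction l with
  | nil => simp [processed]
  | cons y l ih =>
    rw [processed_cons hσ, Set.ncard_insert_of_notMem, Set.ncard_insert_of_notMem, ih hl.1,
      List.length_cons]
    · ring
    · rw [mem_processed_involutive hσ]
      exact hl.2.1
    · rw [Set.mem_insert_iff]
      exact fun h => h.elim (hne y) hl.2.1

end Graph

section RegularPair
open IsLocalRing RingTheory.Sequence

theorem exists_isSMulRegular_mem {R : Type*} [CommRing R] [IsNoetherianRing R] {M : Type*}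
    [AddCommGroup M] [Module R M] [Module.Finite R M] (J : Ideal R)
    (hJ : ∀ q ∈ associatedPrimes R M, ¬ J ≤ q) : ∃ a ∈ J, IsSMulRegular M a := by
  by_contra! h
  have hsub : (J : Set R) ⊆ ⋃ q ∈ associatedPrimes R M, q := by
    rw [biUnion_associatedPrimes_eq_compl_regular]
    exact h
  rw [Ideal.subset_union_prime_finite (associatedPrimes.finite R M) ⊥ ⊥
    (fun q hq _ _ => hq.isPrime)] at hsub
  obtain ⟨q, hq, hle⟩ := hsub
  exact hJ q hq hle

theorem mul_ne_bot_of_regular_pair {R : Type*} [CommRing R] [IsLocalRing R] {P Q : Ideal R}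
    (hP : P ≠ ⊥) (hQ : Q ≠ ⊥) {a b : R} (ha : a ∈ P ⊔ Q) (hb : b ∈ P ⊔ Q)
    (hareg : IsSMulRegular R a) (hbreg : IsSMulRegular (QuotSMulTop a R) b) : P * Q ≠ ⊥ := by
  intro hPQ
  have hz : ∀ x ∈ P, ∀ y ∈ Q, x * y = 0 := fun x hx y hy => by
    have := Ideal.mul_mem_mul hx hy
    rwa [hPQ, Ideal.mem_bot] at this
  have ha0 : ∀ x, a * x = 0 → x = 0 := fun x hx => hareg (by simpa using hx)
  obtain ⟨p, hp, q, hq, rfl⟩ := Submodule.mem_sup.1 ha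
  obtain ⟨p', hp', q', hq', rfl⟩ := Submodule.mem_sup.1 hb
  have hmem : ∃ e, p = (p + q) * e := by
    have h1 : (p' + q') • (Submodule.Quotient.mk p : QuotSMulTop (p + q) R) = 0 := by
      rw [← Submodule.Quotient.mk_smul, Submodule.Quotient.mk_eq_zero]
      refine (Submodule.mem_smul_pointwise_iff_exists _ _ _).2 ⟨p', trivial, ?_⟩
      simp only [smul_eq_mul]
      linear_combination hz p' hp' q hq - hz p hp q' hq'
    have h2 : (Submodule.Quotient.mk p : QuotSMulTop (p + q) R) = 0 := hbreg (by simpa using h1)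
    rw [Submodule.Quotient.mk_eq_zero] at h2
    obtain ⟨e, -, he⟩ := (Submodule.mem_smul_pointwise_iff_exists _ _ _).1 h2
    exact ⟨e, he.symm⟩
  obtain ⟨e, he⟩ := hmem
  have hinf : ∀ c ∈ P, c ∈ Q → c = 0 := fun c hc1 hc2 => ha0 c (by
    rw [add_mul, hz p hp c hc2, mul_comm q c, hz c hc1 q hq, add_zero])
  have heq : (1 - e) * p = e * q := by linear_combination he
  have h1 : (1 - e) * p = 0 :=
    hinf _ (Ideal.mul_mem_left _ _ hp) (heq ▸ Ideal.mul_mem_left _ _ hq)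
  have h2 : e * q = 0 := heq ▸ h1
  rcases IsLocalRing.isUnit_or_isUnit_one_sub_self e with hu | hu
  · have hq0 : q = 0 := hu.mul_right_eq_zero.1 h2
    subst hq0
    exact hQ ((Submodule.eq_bot_iff _).2 fun y hy => ha0 y (by rw [add_zero, hz p hp y hy]))
  · have hp0 : p = 0 := hu.mul_right_eq_zero.1 h1
    subst hp0
    exact hP ((Submodule.eq_bot_iff _).2 fun y hy => ha0 y (by
      rw [zero_add, mul_comm, hz y hy q hq]))

theorem exists_regular_pair {S : Type u} [CommRing S] [IsNoetherianRing S] (L : Ideal S)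
    {n k t : ℕ} (hn : ∀ m : Ideal S, m.IsMaximal → m.height ≤ n)
    (p : Ideal (S ⧸ L)) [p.IsMaximal] (J : Ideal (Localization.AtPrime p))
    (hJm : J ≤ maximalIdeal (Localization.AtPrime p))
    (hJ : ∀ q : Ideal (Localization.AtPrime p), q.IsPrime → J ≤ q →
      (k : ℕ∞) ≤ (q.comap (toLocalQuotient L p)).height)
    (hdepth : ((t + 1 : ℕ) : ℕ∞) ≤ localRingDepth (Localization.AtPrime p)) (hkt : n < k + t) :
    ∃ a ∈ J, ∃ b ∈ J, IsSMulRegular (Localization.AtPrime p) a ∧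
      IsSMulRegular (QuotSMulTop a (Localization.AtPrime p)) b := by
  have : IsNoetherianRing (Localization.AtPrime p) :=
    IsLocalization.isNoetherianRing p.primeCompl _ inferInstance
  have key : ∀ {s : ℕ}, t ≤ s → ∀ q : Ideal (Localization.AtPrime p),
      (q.comap (toLocalQuotient L p)).height + s ≤ n → q.IsPrime → ¬ J ≤ q := by
    intro s hs q hq hqp hle
    have h1 : ((k + s : ℕ) : ℕ∞) ≤ n := by
      rw [Nat.cast_add]
      exact (add_le_add_left (hJ q hqp hle) _).trans hq
    have h2 : k + s ≤ n := by exact_mod_cast h1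
    omega
  obtain ⟨rs, hlen, hrs, hr⟩ := exists_isRegular_of_le_localRingDepth hdepth
  obtain ⟨a, haJ, ha⟩ := exists_isSMulRegular_mem (M := Localization.AtPrime p) J fun q hq =>
    key (s := t + 1) (by omega) q (by
      have := height_comap_add_length_le L hn p hrs hr.1 hq
      rwa [hlen] at this) hq.isPrime
  obtain ⟨rs', hlen', hrs', hr'⟩ := exists_isRegular_quotSMulTop hdepth (hJm haJ) ha
  obtain ⟨b, hbJ, hb⟩ := exists_isSMulRegular_mem (M := QuotSMulTop a (Localization.AtPrime p)) J
    fun q hq =>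
    key le_rfl q (by
      have := height_comap_add_length_le L hn p hrs' hr'.1 hq
      rwa [hlen'] at this) hq.isPrime
  exact ⟨a, haJ, b, hbJ, ha, hb⟩

end RegularPair

section EdgeIdeals
open MvPolynomial

theorem edgeIdeal_eq_weightedEdgeIdeal {V : Type*} (K : Type*) [CommSemiring K]
    (G : SimpleGraph V) : edgeIdeal K G = weightedEdgeIdeal K G fun _ => 1 := by
  rw [edgeIdeal, weightedEdgeIdeal]
  congr 2
  exact funext fun e => (pow_one _).symm

variable {V : Type u} {K : Type u} [Field K] {G : SimpleGraph V} {w : Sym2 V → ℕ}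

theorem X_mul_X_pow_mem_weightedEdgeIdeal {u v : V} (h : G.Adj u v) :
    ((X u * X v) ^ w s(u, v) : MvPolynomial V K) ∈ weightedEdgeIdeal K G w :=
  Ideal.subset_span ⟨s(u, v), h, rfl⟩

theorem weightedEdgeIdeal_le_iff {J : Ideal (MvPolynomial V K)} :
    weightedEdgeIdeal K G w ≤ J ↔
      ∀ u v, G.Adj u v → ((X u * X v) ^ w s(u, v) : MvPolynomial V K) ∈ J := by
  refine ⟨fun h u v huv => h (X_mul_X_pow_mem_weightedEdgeIdeal huv), fun h => ?_⟩
  rw [weightedEdgeIdeal, Ideal.span_le]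
  rintro _ ⟨e, he, rfl⟩
  induction e with
  | h u v => exact h u v he

theorem isVertexCover_of_weightedEdgeIdeal_le {Q : Ideal (MvPolynomial V K)} [Q.IsPrime]
    (h : weightedEdgeIdeal K G w ≤ Q) : IsVertexCover G {v | X v ∈ Q} := fun u v huv =>
  Ideal.IsPrime.mem_or_mem ‹_› (Ideal.IsPrime.mem_of_pow_mem ‹_› _
    (h (X_mul_X_pow_mem_weightedEdgeIdeal huv)))

theorem weightedEdgeIdeal_le_of_isVertexCover (hw : ∀ e ∈ G.edgeSet, 0 < w e)
    {J : Ideal (MvPolynomial V K)} (h : IsVertexCover G {v | X v ∈ J}) :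
    weightedEdgeIdeal K G w ≤ J := by
  rw [weightedEdgeIdeal_le_iff]
  intro u v huv
  refine Ideal.pow_mem_of_mem _ ?_ _ (hw _ huv)
  rcases h huv with h | h
  · exact Ideal.mul_mem_right _ _ h
  · exact Ideal.mul_mem_left _ _ h

theorem IsVertexCover.isIndepSet_compl {C : Set V} (h : IsVertexCover G C) : IsIndepSet G Cᶜ :=
  fun _ hu _ hv _ huv => (h huv).elim hu hv

theorem IsIndepSet.isVertexCover_compl {A : Set V} (h : IsIndepSet G A) : IsVertexCover G Aᶜ := by
  intro u v huv
  by_contra! hc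
  simp only [Set.mem_compl_iff, not_not] at hc
  exact h hc.1 hc.2 huv.ne huv

theorem weightedEdgeIdeal_le_varsIdeal (hw : ∀ e ∈ G.edgeSet, 0 < w e) {C : Set V}
    (h : IsVertexCover G C) : weightedEdgeIdeal K G w ≤ varsIdeal K C :=
  weightedEdgeIdeal_le_of_isVertexCover hw fun _ _ huv =>
    (h huv).imp (X_mem_varsIdeal (K := K)) (X_mem_varsIdeal (K := K))

variable [Fintype V]

theorem ncard_le_height {Q : Ideal (MvPolynomial V K)} [Q.IsPrime] {T : Set V}
    (hT : ∀ v ∈ T, (X v : MvPolynomial V K) ∈ Q) : (T.ncard : ℕ∞) ≤ Q.height := by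
  have := card_le_height T.toFinite.toFinset Q (by simpa using hT)
  rwa [← Set.ncard_eq_toFinset_card] at this

theorem IsVeryWellCovered.card_div_two_le_ncard (hG : IsVeryWellCovered G) {C : Set V}
    (hC : IsVertexCover G C) : Fintype.card V / 2 ≤ C.ncard := by
  have h1 := hG.ncard_le hC.isIndepSet_compl
  have h2 := Set.ncard_add_ncard_compl C
  rw [Nat.card_eq_fintype_card] at h2
  omega

theorem le_height_of_weightedEdgeIdeal_le (hG : IsVeryWellCovered G)
    {Q : Ideal (MvPolynomial V K)} [Q.IsPrime] (h : weightedEdgeIdeal K G w ≤ Q) :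
    ((Fintype.card V / 2 : ℕ) : ℕ∞) ≤ Q.height :=
  le_trans (by exact_mod_cast hG.card_div_two_le_ncard (isVertexCover_of_weightedEdgeIdeal_le h))
    (ncard_le_height (T := {v | X v ∈ Q}) fun _ hv => hv)

theorem IsVeryWellCovered.exists_vertexCover_subset (hG : IsVeryWellCovered G) {C : Set V}
    (hC : IsVertexCover G C) :
    ∃ D ⊆ C, IsVertexCover G D ∧ D.ncard = Fintype.card V / 2 := by
  obtain ⟨B, hsub, hB⟩ := exists_isMaxIndepSet hC.isIndepSet_compl
  refine ⟨Bᶜ, Set.compl_subset_comm.1 hsub, hB.1.isVertexCover_compl, ?_⟩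
  have h1 := hG.2.2 B hB
  have h2 := Set.ncard_add_ncard_compl B
  have h3 := hG.2.1
  rw [Nat.card_eq_fintype_card] at h2
  rw [Nat.even_iff] at h3
  omega

theorem le_height_of_isMaximal_quotient (hG : IsVeryWellCovered G)
    (hw : ∀ e ∈ G.edgeSet, 0 < w e) (p : Ideal (MvPolynomial V K ⧸ weightedEdgeIdeal K G w))
    [p.IsMaximal] : ((Fintype.card V / 2 : ℕ) : ℕ∞) ≤ p.height := by
  obtain ⟨D, hDC, hD, hcard⟩ := hG.exists_vertexCover_subset
    (isVertexCover_of_weightedEdgeIdeal_le (le_preimageIdeal _ p))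
  have h1 := card_le_card_add_height (weightedEdgeIdeal K G w) p D.toFinite.toFinset
    (fun v hv => hDC (by simpa using hv))
    (by simpa using weightedEdgeIdeal_le_varsIdeal hw hD)
  rw [← Set.ncard_eq_toFinset_card, hcard] at h1
  have h2 : Fintype.card V = Fintype.card V / 2 + Fintype.card V / 2 := by
    have := Nat.even_iff.1 hG.2.1
    omega
  nth_rw 1 [h2] at h1
  rw [Nat.cast_add] at h1
  exact (ENat.add_le_add_iff_right (ENat.natCast_ne_top _)).1 h1

theorem isUnmixedIdeal_weightedEdgeIdeal_of_isCohenMacaulayRing (hG : IsVeryWellCovered G)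
    (hw : ∀ e ∈ G.edgeSet, 0 < w e)
    (hCM : IsCohenMacaulayRing (MvPolynomial V K ⧸ weightedEdgeIdeal K G w)) :
    IsUnmixedIdeal (weightedEdgeIdeal K G w) :=
  isUnmixedIdeal_of_isCohenMacaulayRing _ (n := Fintype.card V) (h := Fintype.card V / 2)
    (t := Fintype.card V / 2)
    (fun m hm => (height_of_isMaximal m).le)
    (fun _ _ => le_height_of_weightedEdgeIdeal_le hG)
    (by have := Nat.even_iff.1 hG.2.1; omega)
    (fun p _ => le_height_of_isMaximal_quotient hG hw p) hCM

end EdgeIdeals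

section CohenMacaulayGraph
open MvPolynomial IsLocalRing

variable {V : Type u} {K : Type u} [Field K] {G : SimpleGraph V} {w : Sym2 V → ℕ} [Fintype V]

omit [Fintype V] in
open Classical in
theorem exists_isMaximal_X_mem_iff (F : Set V) :
    ∃ m : Ideal (MvPolynomial V K), m.IsMaximal ∧ ∀ v, X v ∈ m ↔ v ∉ F := by
  let ev : MvPolynomial V K →ₐ[K] K := aeval fun v => if v ∈ F then 1 else 0
  refine ⟨RingHom.ker ev, RingHom.ker_isMaximal_of_surjective ev fun c => ⟨C c, by simp [ev]⟩,
    fun v => ?_⟩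
  rw [RingHom.mem_ker]
  simp [ev]

omit [Fintype V] in
theorem IsIndepSet.insert {A : Set V} (hA : IsIndepSet G A) {v : V}
    (h : ∀ u ∈ A, ¬ G.Adj u v) : IsIndepSet G (insert v A) := by
  rintro a (rfl | ha) b (rfl | hb) hab
  exacts [fun _ => hab rfl, fun h' => h b hb h'.symm, h a ha, hA ha hb hab]

theorem IsVeryWellCovered.not_adj_matching_of_isCohenMacaulayRing (hG : IsVeryWellCovered G)
    (hw : ∀ e ∈ G.edgeSet, w e = 1)
    (hCM : IsCohenMacaulayRing (MvPolynomial V K ⧸ weightedEdgeIdeal K G w))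
    {σ : V → V} (hσ : Function.Involutive σ) (hadj : ∀ v, G.Adj v (σ v)) {x z : V}
    (hxz : G.Adj x z) (hz : z ≠ σ x) : ¬ G.Adj (σ x) (σ z) := by
  intro hyz
  have hw0 : ∀ e ∈ G.edgeSet, 0 < w e := fun e he => by rw [hw e he]; exact one_pos
  have hxx : x ≠ σ z := fun h => hz (by rw [h, hσ z])
  have hxx' : ¬ G.Adj x (σ z) := fun h =>
    (ne_and_adj_of_adj_matching hG hσ hadj hxz h).1 rfl
  obtain ⟨F, -, ⟨hFi, hFN⟩, hFmax⟩ := Finite.exists_le_maximal (α := Set V)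
    (p := fun F => IsIndepSet G F ∧ ∀ v ∈ F, ¬ G.Adj v x ∧ ¬ G.Adj v (σ x)) (a := ∅)
    ⟨Set.pairwise_empty _, by simp⟩
  have hcover : ∀ v, v ∉ F → (∃ f ∈ F, G.Adj f v) ∨ G.Adj v x ∨ G.Adj v (σ x) := by
    intro v hv
    by_contra! hc
    refine hv (hFmax (y := insert v F) ⟨?_, ?_⟩ (Set.subset_insert _ _) (Set.mem_insert _ _))
    · exact hFi.insert hc.1
    · rintro u (rfl | hu)
      exacts [hc.2, hFN u hu]
  have hxF : x ∉ F := fun h => (hFN x h).2 (hadj x)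
  have hyF : σ x ∉ F := fun h => (hFN _ h).1 (hadj x).symm
  have hxF2 : σ z ∉ F := fun h => (hFN _ h).2 hyz.symm
  have hindx : IsIndepSet G (insert x F) :=
    hFi.insert fun f hf => (hFN f hf).1
  have hindy : IsIndepSet G (insert (σ x) F) :=
    hFi.insert fun f hf => (hFN f hf).2
  have hcardF : F.ncard + 2 ≤ Fintype.card V / 2 := by
    have hind : IsIndepSet G (insert (σ z) (insert x F)) := by
      refine hindx.insert ?_
      rintro f (rfl | hf) h
      · exact hxx' h
      · exact (hFN f hf).1 (ne_and_adj_of_adj_matching hG hσ hadj hxz h).2.symm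
    have := hG.ncard_le hind
    rwa [Set.ncard_insert_of_notMem (by simpa using ⟨hxx.symm, hxF2⟩),
      Set.ncard_insert_of_notMem hxF] at this
  obtain ⟨m, hm, hmX⟩ := exists_isMaximal_X_mem_iff (K := K) F
  set L := weightedEdgeIdeal K G w with hLdef
  have hLm : L ≤ m := weightedEdgeIdeal_le_of_isVertexCover hw0 (by
    convert hFi.isVertexCover_compl using 1
    ext v
    exact hmX v)
  obtain ⟨p, hp, rfl⟩ := exists_preimageIdeal_eq _ hm hLm
  have hmul : ∀ u v, G.Adj u v → (X u * X v : MvPolynomial V K) ∈ L := fun u v huv => by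
    have := X_mul_X_pow_mem_weightedEdgeIdeal (K := K) (w := w) huv
    rwa [hw _ huv, pow_one] at this
  have hne : ∀ v, v ∉ F → IsIndepSet G (insert v F) → toLocalQuotient L p (X v) ≠ 0 := by
    intro v hvF hv h0
    obtain ⟨s, hs, hsv⟩ := (toLocalQuotient_eq_zero_iff L p).1 h0
    have hmem := weightedEdgeIdeal_le_varsIdeal hw0 hv.isVertexCover_compl hsv
    rcases (isPrime_varsIdeal (K := K) (insert v F)ᶜ).mem_or_mem hmem with h | h
    · exact hs ((varsIdeal_le_iff (C := (insert v F)ᶜ)).2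
        (fun u hu => (hmX u).2 fun huF => hu (Set.mem_insert_of_mem _ huF)) h)
    · exact X_mem_varsIdeal_iff.1 h (Set.mem_insert _ _)
  have hmem : ∀ {y v : V}, G.Adj v y → X v ∈ varsIdeal K {v | G.Adj v y} :=
    fun h => X_mem_varsIdeal h
  set P := (varsIdeal K {v | G.Adj v (σ x)}).map (toLocalQuotient L p) with hPdef
  set Q := (varsIdeal K {v | G.Adj v x}).map (toLocalQuotient L p) with hQdef
  have hP : P ≠ ⊥ := fun h => hne x hxF hindx (by
    rw [← Ideal.mem_bot, ← h]
    exact Ideal.mem_map_of_mem _ (hmem (hadj x)))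
  have hQ : Q ≠ ⊥ := fun h => hne (σ x) hyF hindy (by
    rw [← Ideal.mem_bot, ← h]
    exact Ideal.mem_map_of_mem _ (hmem (hadj x).symm))
  have hPQ : P * Q = ⊥ := by
    rw [hPdef, hQdef, ← Ideal.map_mul, Ideal.map_eq_bot_iff_le_ker, varsIdeal, varsIdeal,
      Ideal.span_mul_span', Ideal.span_le]
    rintro _ ⟨_, ⟨a, ha, rfl⟩, _, ⟨b, hb, rfl⟩, rfl⟩
    exact toLocalQuotient_eq_zero_of_mem L p
      (hmul a b (ne_and_adj_of_adj_matching hG hσ hadj hb ha).2.symm)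
  have hle : ∀ y ∉ F, (∀ v ∈ F, ¬ G.Adj v y) → (varsIdeal K {v | G.Adj v y}).map
      (toLocalQuotient L p) ≤ maximalIdeal (Localization.AtPrime p) := by
    intro y _ hy
    rw [Ideal.map_le_iff_le_comap, varsIdeal_le_iff]
    intro v hv
    rw [Ideal.mem_comap, toLocalQuotient_mem_maximalIdeal_iff, hmX]
    exact fun hvF => hy v hvF hv
  have hht : ∀ q : Ideal (Localization.AtPrime p), q.IsPrime → P ⊔ Q ≤ q →
      (Fᶜ.ncard : ℕ∞) ≤ (q.comap (toLocalQuotient L p)).height := by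
    intro q hq hJq
    refine ncard_le_height fun v hv => ?_
    rw [Ideal.mem_comap]
    rcases hcover v hv with ⟨f, hf, hfv⟩ | hvx | hvy
    · have : toLocalQuotient L p (X v) = 0 := (toLocalQuotient_eq_zero_iff L p).2
        ⟨X f, fun h => (hmX f).1 h hf, hmul f v hfv⟩
      rw [this]
      exact Ideal.zero_mem _
    · exact hJq (Ideal.mem_sup_right (Ideal.mem_map_of_mem _ (hmem hvx)))
    · exact hJq (Ideal.mem_sup_left (Ideal.mem_map_of_mem _ (hmem hvy)))
  have h2 := Set.ncard_add_ncard_compl F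
  rw [Nat.card_eq_fintype_card] at h2
  have hdepth := le_localRingDepth_of_isCohenMacaulayRing L hCM p
    (le_height_of_isMaximal_quotient hG hw0 p)
  obtain ⟨t, ht⟩ : ∃ t, Fintype.card V / 2 = t + 1 := ⟨Fintype.card V / 2 - 1, by omega⟩
  rw [ht] at hdepth
  obtain ⟨a, ha, b, hb, hareg, hbreg⟩ := exists_regular_pair L
    (fun m hm => (height_of_isMaximal m).le) p (P ⊔ Q)
    (sup_le (hle _ hyF fun v hv => (hFN v hv).2) (hle _ hxF fun v hv => (hFN v hv).1))
    hht hdepth (by omega)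
  exact mul_ne_bot_of_regular_pair hP hQ ha hb hareg hbreg hPQ

end CohenMacaulayGraph

section MonomialIdeals
open MvPolynomial

variable {V : Type u} {K : Type u} [Field K] {G : SimpleGraph V} {w : Sym2 V → ℕ}

/-- The monomial ideal generated by the monomials with exponents in `Γ`. -/
noncomputable def monomialIdeal (K : Type*) [Field K] {V : Type*} (Γ : Set (V →₀ ℕ)) :
    Ideal (MvPolynomial V K) :=
  Ideal.span ((fun e => monomial e 1) '' Γ)

theorem mem_monomialIdeal_iff {Γ : Set (V →₀ ℕ)} {f : MvPolynomial V K} :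
    f ∈ monomialIdeal K Γ ↔ ∀ e ∈ f.support, e ∈ upperClosure Γ :=
  mem_ideal_span_monomial_image

theorem monomial_mem_monomialIdeal_iff {Γ : Set (V →₀ ℕ)} {e : V →₀ ℕ} :
    (monomial e 1 : MvPolynomial V K) ∈ monomialIdeal K Γ ↔ e ∈ upperClosure Γ := by
  classical
  rw [mem_monomialIdeal_iff, support_monomial, if_neg one_ne_zero]
  simp

/-- If two multiples of a monomial by the variables `x` and `y` lie in the monomial ideal of `Γ`,
then so does the monomial. -/
def IsSaturatedAt {V : Type*} (Γ : Set (V →₀ ℕ)) (x y : V) : Prop :=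
  ∀ e, e + Finsupp.single x 1 ∈ upperClosure Γ → e + Finsupp.single y 1 ∈ upperClosure Γ →
    e ∈ upperClosure Γ

/-- The exponents of the generators of the weighted edge ideal. -/
def edgeExponents {V : Type*} (G : SimpleGraph V) (w : Sym2 V → ℕ) : Set (V →₀ ℕ) :=
  {g | ∃ u v, G.Adj u v ∧ g = Finsupp.single u (w s(u, v)) + Finsupp.single v (w s(u, v))}

theorem weightedEdgeIdeal_eq_monomialIdeal :
    weightedEdgeIdeal K G w = monomialIdeal K (edgeExponents G w) := by
  have key : ∀ u v, (X u * X v) ^ w s(u, v) = (monomial (Finsupp.single u (w s(u, v)) +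
      Finsupp.single v (w s(u, v))) 1 : MvPolynomial V K) := fun u v => by
    rw [mul_pow, X_pow_eq_monomial, X_pow_eq_monomial, monomial_mul, one_mul]
  refine le_antisymm ?_ ?_
  · rw [weightedEdgeIdeal_le_iff]
    intro u v huv
    rw [key]
    exact Ideal.subset_span ⟨_, ⟨u, v, huv, rfl⟩, rfl⟩
  · rw [monomialIdeal, Ideal.span_le]
    rintro _ ⟨_, ⟨u, v, huv, rfl⟩, rfl⟩
    have := X_mul_X_pow_mem_weightedEdgeIdeal (K := K) (w := w) huv
    rwa [key] at this

theorem isSaturatedAt_edgeExponents_of_isUnmixedIdeal [Fintype V] (hG : IsVeryWellCovered G)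
    (hw : ∀ e ∈ G.edgeSet, 0 < w e) (hU : IsUnmixedIdeal (weightedEdgeIdeal K G w))
    {σ : V → V} (hσ : Function.Involutive σ) (hadj : ∀ v, G.Adj v (σ v)) (x : V) :
    IsSaturatedAt (edgeExponents G w) x (σ x) := by
  intro e hx hy
  by_contra he
  rw [← monomial_mem_monomialIdeal_iff (K := K), ← weightedEdgeIdeal_eq_monomialIdeal] at hx hy he
  set L := weightedEdgeIdeal K G w
  obtain ⟨p, hp, hpL⟩ := exists_associatedPrime_of_notMem L he
  have hpp : p.IsPrime := hp.isPrime
  have hX : ∀ v, monomial (e + Finsupp.single v 1) 1 ∈ L → (X v : MvPolynomial V K) ∈ p :=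
    fun v hv => hpL _ (by rwa [X, monomial_mul, one_mul, add_comm])
  have hcover := isVertexCover_of_weightedEdgeIdeal_le (G := G) (w := w) (Q := p)
    fun s hs => hpL s (Ideal.mul_mem_right _ _ hs)
  set T := {v | (X v : MvPolynomial V K) ∈ p} with hT
  have hsub : σ '' Tᶜ ⊆ T \ {x, σ x} := by
    rintro _ ⟨v, hv, rfl⟩
    refine ⟨(hcover (hadj v)).resolve_left hv, ?_⟩
    rintro (h | h)
    · exact hv (by rw [← hσ v, h]; exact hX _ hy)
    · exact hv (by rw [hσ.injective h]; exact hX _ hx)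
  have h1 := Set.ncard_le_ncard hsub
  have hpair : ({x, σ x} : Set V) ⊆ T := by
    rintro v (rfl | rfl)
    exacts [hX _ hx, hX _ hy]
  rw [Set.ncard_image_of_injective _ hσ.injective, Set.ncard_sdiff hpair,
    Set.ncard_pair (hadj x).ne] at h1
  have h2 := Set.ncard_add_ncard_compl T
  rw [Nat.card_eq_fintype_card] at h2
  have h3 := Set.ncard_le_ncard hpair
  rw [Set.ncard_pair (hadj x).ne] at h3
  have h4 : (T.ncard : ℕ∞) ≤ p.height := ncard_le_height fun _ hv => hv
  obtain ⟨D, -, hD, hDcard⟩ := hG.exists_vertexCover_subset (C := Set.univ)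
    fun _ _ _ => Or.inl trivial
  have hprime := isPrime_varsIdeal (K := K) D
  obtain ⟨q, hq, hqD⟩ := Ideal.exists_minimalPrimes_le
    (weightedEdgeIdeal_le_varsIdeal (K := K) hw hD)
  have hqa : q ∈ associatedPrimes (MvPolynomial V K) (MvPolynomial V K ⧸ L) := by
    refine Module.associatedPrimes.minimalPrimes_annihilator_subset_associatedPrimes _ _ ?_
    rwa [Ideal.annihilator_quotient]
  have hqp : q.IsPrime := hqa.isPrime
  have h5 : q.height ≤ (D.ncard : ℕ∞) := by
    refine (Ideal.height_mono hqD).trans ?_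
    have hmin : varsIdeal K D ∈ (Ideal.span (X '' D)).minimalPrimes := by
      rw [← varsIdeal.eq_def, Ideal.minimalPrimes_eq_subsingleton_self]
      rfl
    refine (Ideal.height_le_card_of_mem_minimalPrimes_span (D.toFinite.image _) hmin).trans ?_
    exact_mod_cast Set.ncard_image_le D.toFinite
  have h6 := hU p hp q hqa
  rw [idealHeight_eq_height, idealHeight_eq_height] at h6
  have h7 : p.height = q.height := by exact_mod_cast h6
  have h8 : T.ncard ≤ D.ncard := by exact_mod_cast h4.trans (h7.le.trans h5)
  omega

end MonomialIdeals

section Nonzerodivisors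
open MvPolynomial

variable {V : Type u} {K : Type u} [Field K]

theorem add_mem_upperClosure {Γ : Set (V →₀ ℕ)} {e : V →₀ ℕ} (h : e ∈ upperClosure Γ)
    (d : V →₀ ℕ) : e + d ∈ upperClosure Γ :=
  (upperClosure Γ).upper le_self_add h

theorem IsSaturatedAt.mem_of_add_single_mem {Γ : Set (V →₀ ℕ)} {x y : V}
    (h : IsSaturatedAt Γ x y) {e : V →₀ ℕ} {j k : ℕ}
    (hx : e + Finsupp.single x j ∈ upperClosure Γ)
    (hy : e + Finsupp.single y k ∈ upperClosure Γ) : e ∈ upperClosure Γ := by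
  have key : ∀ (j : ℕ) (e : V →₀ ℕ), e + Finsupp.single x j ∈ upperClosure Γ →
      e + Finsupp.single y 1 ∈ upperClosure Γ → e ∈ upperClosure Γ := by
    intro j
    induction j with
    | zero => exact fun e hx _ => by simpa using hx
    | succ j ih =>
      intro e hx hy
      rw [Finsupp.single_add, ← add_assoc] at hx
      refine ih e (h _ hx ?_) hy
      rw [add_right_comm]
      exact add_mem_upperClosure hy _
  induction k with
  | zero => simpa using hy
  | succ k ih =>
    rw [Finsupp.single_add, ← add_assoc] at hy
    refine ih (key j _ ?_ hy)
    rw [add_right_comm]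
    exact add_mem_upperClosure hx _

/-- The exponents in the support of `f` outside the monomial ideal of `Γ` that agree with `e₀` up to
a shift between `x` and `y`. -/
def fiber (Γ : Set (V →₀ ℕ)) (f : MvPolynomial V K) (x y : V) (e₀ : V →₀ ℕ) : Set (V →₀ ℕ) :=
  {e | e ∈ f.support ∧ e ∉ upperClosure Γ ∧ e x + e y = e₀ x + e₀ y ∧
    ∀ v, v ≠ x → v ≠ y → e v = e₀ v}

theorem fiber_comm (Γ : Set (V →₀ ℕ)) (f : MvPolynomial V K) (x y : V) (e₀ : V →₀ ℕ) :
    fiber Γ f x y e₀ = fiber Γ f y x e₀ := by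
  ext e
  simp only [fiber, Set.mem_ofPred_eq, add_comm (e x), add_comm (e₀ x)]
  exact and_congr_right' (and_congr_right' (and_congr_right' (forall_congr' fun v =>
    ⟨fun h a b => h b a, fun h a b => h b a⟩)))

theorem exists_mem_fiber_add_single_mem {Γ : Set (V →₀ ℕ)} {x y : V} (hxy : x ≠ y)
    {f : MvPolynomial V K} (hf : (X x - X y) * f ∈ monomialIdeal K Γ) {e₀ : V →₀ ℕ}
    (he₀ : e₀ ∈ fiber Γ f x y e₀) :
    ∃ e ∈ fiber Γ f x y e₀, (∀ e' ∈ fiber Γ f x y e₀, e' x ≤ e x) ∧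
      e + Finsupp.single x 1 ∈ upperClosure Γ := by
  classical
  have hfin : (fiber Γ f x y e₀).Finite := f.support.finite_toSet.subset fun e he => he.1
  obtain ⟨e, he, hmax⟩ := hfin.exists_maximalFor (fun e => e x) _ ⟨e₀, he₀⟩
  have hmax' : ∀ e' ∈ fiber Γ f x y e₀, e' x ≤ e x := fun e' he' =>
    (le_total (e' x) (e x)).elim id (hmax he')
  refine ⟨e, he, hmax', ?_⟩
  by_contra hcon
  have hcoeff : coeff (e + Finsupp.single x 1) ((X x - X y) * f) = 0 := by
    by_contra hne
    exact hcon (mem_monomialIdeal_iff.1 hf _ (mem_support_iff.2 hne))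
  rw [sub_mul, coeff_sub, add_comm e, coeff_X_mul, coeff_X_mul'] at hcoeff
  have hne := mem_support_iff.1 he.1
  split_ifs at hcoeff with hy
  · set d := Finsupp.single x 1 + e - Finsupp.single y 1 with hd
    have hle : Finsupp.single y 1 ≤ Finsupp.single x 1 + e := by
      rw [Finsupp.single_le_iff]
      exact Nat.one_le_iff_ne_zero.2 (Finsupp.mem_support_iff.1 hy)
    have hdadd : d + Finsupp.single y 1 = Finsupp.single x 1 + e := tsub_add_cancel_of_le hle
    have happ : ∀ v, d v + Finsupp.single y 1 v = Finsupp.single x 1 v + e v := fun v => by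
      rw [← Finsupp.add_apply, hdadd, Finsupp.add_apply]
    have hdx := happ x
    have hdy := happ y
    simp only [Finsupp.single_apply, if_neg hxy, if_neg hxy.symm, if_true] at hdx hdy
    have hdmem : d ∈ fiber Γ f x y e₀ := by
      refine ⟨mem_support_iff.2 fun h0 => hne (by rw [h0, sub_zero] at hcoeff; exact hcoeff), ?_,
        by have := he.2.2.1; omega, fun v hvx hvy => ?_⟩
      · intro h
        apply hcon
        rw [add_comm, ← hdadd]
        exact add_mem_upperClosure h _
      · have := happ v
        rw [Finsupp.single_apply, Finsupp.single_apply, if_neg hvx.symm, if_neg hvy.symm] at this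
        rw [← he.2.2.2 v hvx hvy]
        omega
    have := hmax' d hdmem
    omega
  · exact hne (by rwa [sub_zero] at hcoeff)

theorem IsSaturatedAt.mem_of_sub_mul_mem {Γ : Set (V →₀ ℕ)} {x y : V} (h : IsSaturatedAt Γ x y)
    (hxy : x ≠ y) {f : MvPolynomial V K} (hf : (X x - X y) * f ∈ monomialIdeal K Γ) :
    f ∈ monomialIdeal K Γ := by
  rw [mem_monomialIdeal_iff]
  intro e₀ he₀
  by_contra hcon
  have hmem : e₀ ∈ fiber Γ f x y e₀ := ⟨he₀, hcon, rfl, fun _ _ _ => rfl⟩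
  obtain ⟨e, he, hmax, hex⟩ := exists_mem_fiber_add_single_mem hxy hf hmem
  obtain ⟨e', he', -, hey⟩ := exists_mem_fiber_add_single_mem hxy.symm (e₀ := e₀)
    (by rw [← neg_sub, neg_mul]; exact Ideal.neg_mem_iff _ |>.2 hf) (by rwa [fiber_comm])
  rw [fiber_comm] at he'
  have hle := hmax e' he'
  obtain ⟨s, hs⟩ := Nat.exists_eq_add_of_le hle
  obtain ⟨m, hm⟩ : ∃ m, e = m + Finsupp.single x s := by
    refine ⟨e - Finsupp.single x s, (tsub_add_cancel_of_le ?_).symm⟩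
    rw [Finsupp.single_le_iff]
    omega
  have happ : ∀ v, e v = m v + Finsupp.single x s v := fun v => by rw [hm, Finsupp.add_apply]
  have hm' : e' = m + Finsupp.single y s := by
    ext v
    rw [Finsupp.add_apply]
    have h1 := happ x
    have h2 := happ y
    have h3 := happ v
    have h4 := he.2.2.1
    have h5 := he'.2.2.1
    rw [Finsupp.single_eq_same] at h1
    rw [Finsupp.single_eq_of_ne hxy.symm] at h2
    by_cases hvy : v = y
    · subst hvy
      rw [Finsupp.single_eq_same]
      omega
    · rw [Finsupp.single_eq_of_ne hvy]
      by_cases hvx : v = x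
      · subst hvx
        omega
      · rw [Finsupp.single_eq_of_ne hvx] at h3
        rw [he'.2.2.2 v hvx hvy, ← he.2.2.2 v hvx hvy, h3]
  refine he.2.1 ?_
  rw [hm]
  refine add_mem_upperClosure (h.mem_of_add_single_mem (j := s + 1) (k := s + 1) ?_ ?_) _
  · rwa [Finsupp.single_add, ← add_assoc, ← hm]
  · rwa [Finsupp.single_add, ← add_assoc, ← hm']

open Classical in
theorem mem_of_aeval_X_mul_mem {T : Set (MvPolynomial V K)} {u : V} (hT : ∀ t ∈ T, u ∉ t.vars)
    {q : Polynomial K} (hq : q.Monic) {f : MvPolynomial V K}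
    (hf : Polynomial.aeval (X u) q * f ∈ Ideal.span T) : f ∈ Ideal.span T := by
  set W := Ideal.span T
  let Φ : MvPolynomial V K →ₐ[K] Polynomial (MvPolynomial V K) :=
    aeval fun v => if v = u then Polynomial.X else Polynomial.C (X v)
  have hΦT : ∀ t ∈ T, Φ t = Polynomial.C t := by
    intro t ht
    refine MvPolynomial.hom_congr_vars (f₁ := (Φ : MvPolynomial V K →+* _)) (f₂ := Polynomial.C)
      ?_ ?_ rfl
    · ext c
      simp [Φ]
    · intro v hv _
      have : v ≠ u := fun h => hT t ht (h ▸ hv)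
      simp [Φ, this]
  have hΦW : ∀ g ∈ W, Φ g ∈ W.map Polynomial.C := by
    have : W ≤ (W.map Polynomial.C).comap Φ := by
      rw [Ideal.span_le]
      intro t ht
      rw [SetLike.mem_coe, Ideal.mem_comap, hΦT t ht]
      exact Ideal.mem_map_of_mem _ (Ideal.subset_span ht)
    exact this
  have hΦq : Φ (Polynomial.aeval (X u) q) = q.map (algebraMap K (MvPolynomial V K)) := by
    rw [← Polynomial.aeval_algHom_apply]
    have : Φ (X u) = Polynomial.X := by simp [Φ]
    rw [this]
    clear hq hf
    induction q using Polynomial.induction_on' with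
    | add p q hp hq => rw [map_add, hp, hq, Polynomial.map_add]
    | monomial n a => simp [← Polynomial.C_mul_X_pow_eq_monomial]
  have heval : ∀ g, (Φ g).eval (X u) = g := by
    intro g
    induction g using MvPolynomial.induction_on with
    | C a => simp [Φ]
    | add p q hp hq => rw [map_add, Polynomial.eval_add, hp, hq]
    | mul_X p v hp =>
      rw [map_mul, Polynomial.eval_mul, hp]
      by_cases h : v = u <;> simp [Φ, h]
  have hmem := hΦW _ hf
  rw [map_mul, hΦq] at hmem
  have hker : ∀ g, g ∈ W.map Polynomial.C ↔ g.map (Ideal.Quotient.mk W) = 0 := by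
    intro g
    rw [Ideal.mem_map_C_iff, Polynomial.ext_iff]
    simp [Ideal.Quotient.eq_zero_iff_mem]
  have hΦf : Φ f ∈ W.map Polynomial.C := by
    rw [hker, Polynomial.map_mul] at hmem
    rw [hker]
    exact (((hq.map _).map _).mul_right_eq_zero_iff).1 hmem
  rw [← heval f, Polynomial.eval_eq_sum]
  exact Ideal.sum_mem _ fun i _ => Ideal.mul_mem_right _ _ (Ideal.mem_map_C_iff.1 hΦf i)

theorem exists_monic_aeval_X_mem [Finite V] (m : Ideal (MvPolynomial V K)) [m.IsMaximal] (u : V) :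
    ∃ q : Polynomial K, q.Monic ∧ Polynomial.aeval (X u) q ∈ m := by
  let := Ideal.Quotient.field m
  have : Module.Finite K (MvPolynomial V K ⧸ m) := finite_of_finite_type_of_isJacobsonRing _ _
  obtain ⟨q, hq, h0⟩ := Algebra.IsIntegral.isIntegral (R := K) (Ideal.Quotient.mk m (X u))
  refine ⟨q, hq, ?_⟩
  rw [← Ideal.Quotient.eq_zero_iff_mem, ← h0, Polynomial.aeval_def, Polynomial.hom_eval₂]
  rfl

end Nonzerodivisors

section Collapse
open MvPolynomial

/-- The last entry of the list is a nonzerodivisor modulo `J`, the one before it is a nonzerodivisor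
modulo `J` and the last entry, and so on. -/
def IsRegularChain {S : Type*} [CommRing S] (J : Ideal S) : List S → Prop
  | [] => True
  | r :: l => IsRegularChain J l ∧ ∀ f, r * f ∈ J ⊔ Ideal.ofList l → f ∈ J ⊔ Ideal.ofList l

variable {V : Type u} {K : Type u} [Field K]

open Classical in
theorem mapDomain_update_id (y z : V) (g : V →₀ ℕ) :
    g.mapDomain (Function.update id y z) = g.erase y + Finsupp.single z (g y) := by
  conv_lhs => rw [← Finsupp.erase_add_single y g]
  rw [Finsupp.mapDomain_add, Finsupp.mapDomain_single, Function.update_self]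
  congr 1
  rw [Finsupp.mapDomain_congr (g := id), Finsupp.mapDomain_id]
  intro v hv
  rw [Finsupp.support_erase, Finset.mem_erase] at hv
  exact Function.update_of_ne hv.1 _ _

/-- Replacing the variable `y` by the variable `z` in a monomial. -/
noncomputable def collapse (y z : V) (g : V →₀ ℕ) : V →₀ ℕ := g.erase y + Finsupp.single z (g y)

theorem collapse_apply_of_ne {y z v : V} (hy : v ≠ y) (hz : v ≠ z) (g : V →₀ ℕ) :
    collapse y z g v = g v := by
  rw [collapse, Finsupp.add_apply, Finsupp.erase_ne hy, Finsupp.single_eq_of_ne hz, add_zero]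

theorem collapse_of_apply_eq_zero {y z : V} {g : V →₀ ℕ} (h : g y = 0) : collapse y z g = g := by
  rw [collapse, h, Finsupp.single_zero, add_zero, Finsupp.erase_of_notMem_support (by simpa)]

open Classical in
/-- The substitution of the variable `z` for the variable `y`. -/
noncomputable def substitute (K : Type*) [Field K] (y z : V) :
    MvPolynomial V K →ₐ[K] MvPolynomial V K :=
  rename (Function.update id y z)

theorem substitute_X_self (y z : V) : substitute K y z (X y) = X z := by
  simp [substitute]

theorem substitute_X_of_ne {y z v : V} (h : v ≠ y) : substitute K y z (X v) = X v := by
  simp [substitute, h]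

theorem substitute_monomial (y z : V) (g : V →₀ ℕ) :
    substitute K y z (monomial g 1) = monomial (collapse y z g) 1 := by
  rw [substitute, rename_monomial, mapDomain_update_id, collapse]

theorem substitute_sub_mem (y z : V) (f : MvPolynomial V K) :
    substitute K y z f - f ∈ Ideal.span {X y - X z} := by
  induction f using MvPolynomial.induction_on with
  | C a => simp [substitute]
  | add p q hp hq =>
    rw [map_add, add_sub_add_comm]
    exact Ideal.add_mem _ hp hq
  | mul_X p v hp =>
    have : substitute K y z (p * X v) - p * X v = (substitute K y z p - p) * X v +
        substitute K y z p * (substitute K y z (X v) - X v) := by rw [map_mul]; ring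
    rw [this]
    refine Ideal.add_mem _ (Ideal.mul_mem_right _ _ hp) (Ideal.mul_mem_left _ _ ?_)
    by_cases hv : v = y
    · subst hv
      rw [substitute_X_self, ← neg_sub (X v), Ideal.neg_mem_iff]
      exact Ideal.mem_span_singleton_self _
    · rw [substitute_X_of_ne hv, sub_self]
      exact Ideal.zero_mem _

theorem IsSaturatedAt.image_collapse {Γ : Set (V →₀ ℕ)} {x x' y z : V} (h : IsSaturatedAt Γ x x')
    (hxy : x ≠ y) (hxz : x ≠ z) (hxy' : x' ≠ y) (hxz' : x' ≠ z)
    (hΓ : ∀ g ∈ Γ, g y ≠ 0 → g x = 0 ∧ g x' = 0) : IsSaturatedAt (collapse y z '' Γ) x x' := by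
  have key : ∀ {v g e}, g ∈ Γ → v ≠ y → v ≠ z → collapse y z g ≤ e + Finsupp.single v 1 →
      g v = 0 → e ∈ upperClosure (collapse y z '' Γ) := by
    intro v g e hg hvy hvz hle h0
    refine ⟨_, ⟨g, hg, rfl⟩, fun a => ?_⟩
    by_cases hav : a = v
    · subst hav
      rw [collapse_apply_of_ne hvy hvz, h0]
      exact Nat.zero_le _
    · have := hle a
      rwa [Finsupp.add_apply, Finsupp.single_eq_of_ne hav, add_zero] at this
  have key' : ∀ {v g e}, g ∈ Γ → v ≠ y → collapse y z g ≤ e + Finsupp.single v 1 →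
      g y = 0 → e.erase y + Finsupp.single v 1 ∈ upperClosure Γ := by
    intro v g e hg hvy hle h0
    rw [collapse_of_apply_eq_zero h0] at hle
    refine ⟨g, hg, fun a => ?_⟩
    by_cases hay : a = y
    · subst hay
      rw [h0]
      exact Nat.zero_le _
    · have := hle a
      rwa [Finsupp.add_apply, Finsupp.erase_ne hay, ← Finsupp.add_apply]
  rintro e ⟨_, ⟨g, hg, rfl⟩, hge⟩ ⟨_, ⟨g', hg', rfl⟩, hge'⟩
  by_cases hgy : g y = 0
  swap
  · exact key hg hxy hxz hge (hΓ g hg hgy).1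
  by_cases hgy' : g' y = 0
  swap
  · exact key hg' hxy' hxz' hge' (hΓ g' hg' hgy').2
  obtain ⟨k, hk, hke⟩ := h _ (key' hg hxy hge hgy) (key' hg' hxy' hge' hgy')
  have hky : k y = 0 := by
    have := hke y
    rwa [Finsupp.erase_same, Nat.le_zero] at this
  refine ⟨_, ⟨k, hk, rfl⟩, ?_⟩
  rw [collapse_of_apply_eq_zero hky]
  refine hke.trans fun a => ?_
  by_cases hay : a = y
  · rw [hay, Finsupp.erase_same]
    exact Nat.zero_le _
  · rw [Finsupp.erase_ne hay]

open Classical in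
/-- The differences of the variables of the matching edges of `l` that avoid `U`. -/
noncomputable def matchingDifferences (K : Type*) [Field K] (σ : V → V) (U : Set V) (l : List V) :
    List (MvPolynomial V K) :=
  (l.filter fun y => y ∉ U ∧ σ y ∉ U).map fun y => X y - X (σ y)

theorem matchingDifferences_cons_of_pos {σ : V → V} {U : Set V} {y : V} (h : y ∉ U ∧ σ y ∉ U)
    (l : List V) : matchingDifferences K σ U (y :: l) =
      (X y - X (σ y)) :: matchingDifferences K σ U l := by
  rw [matchingDifferences, List.filter_cons_of_pos (by simpa using h)]
  rfl

theorem matchingDifferences_cons_of_neg {σ : V → V} {U : Set V} {y : V} (h : ¬ (y ∉ U ∧ σ y ∉ U))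
    (l : List V) : matchingDifferences K σ U (y :: l) = matchingDifferences K σ U l := by
  rw [matchingDifferences, List.filter_cons_of_neg (by simpa using h)]
  rfl

variable {G : SimpleGraph V} {σ : V → V} {U : Set V} {Γ : Set (V →₀ ℕ)}

theorem exists_collapse_matchingDifferences (hσ : Function.Involutive σ)
    (hadj : ∀ v, G.Adj v (σ v))
    (hΓ : ∀ v, v ∉ U → σ v ∉ U → IsSaturatedAt Γ v (σ v))
    (hΓG : ∀ g ∈ Γ, ∀ a b, a ≠ b → g a ≠ 0 → g b ≠ 0 → G.Adj a b) {l : List V}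
    (hl : IsLeafOrder G σ l) :
    ∃ (Γ' : Set (V →₀ ℕ)) (φ : MvPolynomial V K →ₐ[K] MvPolynomial V K),
      (∀ f, φ f - f ∈ Ideal.ofList (matchingDifferences K σ U l)) ∧
      monomialIdeal K Γ' ≤ monomialIdeal K Γ ⊔ Ideal.ofList (matchingDifferences K σ U l) ∧
      monomialIdeal K Γ ⊔ Ideal.ofList (matchingDifferences K σ U l) ≤
        (monomialIdeal K Γ').comap φ ∧
      (∀ v, v ∉ processed σ l → φ (X v) = X v) ∧
      (∀ v, v ∉ processed σ l → v ∉ U → σ v ∉ U → IsSaturatedAt Γ' v (σ v)) ∧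
      (∀ g ∈ Γ', ∀ a b, a ≠ b → a ∉ processed σ l → b ∉ processed σ l → g a ≠ 0 → g b ≠ 0 →
        G.Adj a b) ∧
      IsRegularChain (monomialIdeal K Γ) (matchingDifferences K σ U l) := by
  induction l with
  | nil =>
    refine ⟨Γ, AlgHom.id K _, fun f => by simp, le_sup_left, ?_, fun _ _ => rfl,
      fun v _ => hΓ v, fun g hg a b hab _ _ => hΓG g hg a b hab, trivial⟩
    simp [matchingDifferences, Ideal.ofList_nil]
  | cons y l ih =>
    obtain ⟨Γ', φ, h1, h2, h3, h4, h5, h6, h7⟩ := ih hl.1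
    have hproc : ∀ {v}, v ∉ processed σ (y :: l) → v ≠ y ∧ v ≠ σ y ∧ v ∉ processed σ l := by
      intro v hv
      rw [processed_cons hσ] at hv
      simpa [not_or] using hv
    by_cases hy : y ∉ U ∧ σ y ∉ U
    swap
    · rw [matchingDifferences_cons_of_neg hy]
      exact ⟨Γ', φ, h1, h2, h3, fun v hv => h4 v (hproc hv).2.2,
        fun v hv => h5 v (hproc hv).2.2,
        fun g hg a b hab ha hb => h6 g hg a b hab (hproc ha).2.2 (hproc hb).2.2, h7⟩
    rw [matchingDifferences_cons_of_pos hy, Ideal.ofList_cons]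
    have hy0 : y ∉ processed σ l := hl.2.1
    have hy1 : σ y ∉ processed σ l := by rwa [mem_processed_involutive hσ]
    set D := Ideal.ofList (matchingDifferences K σ U l)
    have hspan : ∀ f, substitute K y (σ y) f - f ∈ Ideal.span {X y - X (σ y)} ⊔ D :=
      fun f => Ideal.mem_sup_left (substitute_sub_mem y (σ y) f)
    have hmono : monomialIdeal K Γ ⊔ D ≤ monomialIdeal K Γ ⊔ (Ideal.span {X y - X (σ y)} ⊔ D) :=
      sup_le_sup le_rfl le_sup_right
    refine ⟨collapse y (σ y) '' Γ', (substitute K y (σ y)).comp φ, ?_, ?_, ?_, ?_, ?_, ?_, h7, ?_⟩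
    · intro f
      rw [← sub_add_sub_cancel ((substitute K y (σ y)).comp φ f) (φ f) f]
      exact Ideal.add_mem _ (hspan _) (Ideal.mem_sup_right (h1 f))
    · rw [monomialIdeal, Ideal.span_le]
      rintro _ ⟨_, ⟨g, hg, rfl⟩, rfl⟩
      have hm := h2 (Ideal.subset_span ⟨g, hg, rfl⟩)
      beta_reduce at hm ⊢
      rw [SetLike.mem_coe, ← substitute_monomial, ← sub_add_cancel (substitute K y (σ y) _)]
      exact Ideal.add_mem _ (Ideal.mem_sup_right (hspan _))
        (hmono hm)
    · have hsub : monomialIdeal K Γ' ≤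
          (monomialIdeal K (collapse y (σ y) '' Γ')).comap (substitute K y (σ y)) := by
        rw [monomialIdeal, Ideal.span_le]
        rintro _ ⟨g, hg, rfl⟩
        rw [SetLike.mem_coe, Ideal.mem_comap, substitute_monomial]
        exact Ideal.subset_span ⟨_, ⟨g, hg, rfl⟩, rfl⟩
      have h3' : ∀ f ∈ monomialIdeal K Γ ⊔ D,
          substitute K y (σ y) (φ f) ∈ monomialIdeal K (collapse y (σ y) '' Γ') :=
        fun f hf => hsub (h3 hf)
      rw [sup_left_comm, sup_le_iff, Ideal.span_singleton_le_iff_mem]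
      refine ⟨?_, h3'⟩
      rw [Ideal.mem_comap, AlgHom.comp_apply, map_sub, h4 _ hy0, h4 _ hy1, map_sub,
        substitute_X_self, substitute_X_of_ne (hadj y).ne.symm, sub_self]
      exact Ideal.zero_mem _
    · intro v hv
      rw [AlgHom.comp_apply, h4 v (hproc hv).2.2, substitute_X_of_ne (hproc hv).1]
    · intro v hv hvU hvU'
      have hv' : σ v ∉ processed σ (y :: l) := by rwa [mem_processed_involutive hσ]
      have hzero : ∀ g ∈ Γ', g y ≠ 0 → ∀ a ∉ processed σ (y :: l), g a = 0 := by
        intro g hg hgy a ha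
        by_contra hga
        obtain ⟨ha1, ha2, ha3⟩ := hproc ha
        exact (hl.2.2 a (h6 g hg y a ha1.symm hy0 ha3 hgy hga)).elim ha2 ha3
      exact (h5 v (hproc hv).2.2 hvU hvU').image_collapse (hproc hv).1 (hproc hv).2.1 (hproc hv').1
        (hproc hv').2.1 fun g hg hgy => ⟨hzero g hg hgy v hv, hzero g hg hgy _ hv'⟩
    · rintro _ ⟨g, hg, rfl⟩ a b hab ha hb
      obtain ⟨ha1, ha2, ha3⟩ := hproc ha
      obtain ⟨hb1, hb2, hb3⟩ := hproc hb
      rw [collapse_apply_of_ne ha1 ha2, collapse_apply_of_ne hb1 hb2]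
      exact h6 g hg a b hab ha3 hb3
    · intro f hf
      have hmem : (X y - X (σ y)) * φ f ∈ monomialIdeal K Γ' := by
        have := h3 hf
        rwa [Ideal.mem_comap, map_mul, map_sub, h4 _ hy0, h4 _ hy1] at this
      have := h2 ((h5 y hy0 hy.1 hy.2).mem_of_sub_mul_mem (hadj y).ne hmem)
      rw [← sub_sub_cancel (φ f) f]
      exact Ideal.sub_mem _ this (Ideal.mem_sup_right (h1 f))

end Collapse

section LocalChain
open IsLocalRing RingTheory.Sequence

theorem isWeaklyRegular_of_isRegularChain {S : Type u} [CommRing S] (L : Ideal S)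
    (p : Ideal (S ⧸ L)) [p.IsPrime] {J : Ideal S} (hLJ : L ≤ J)
    (hJ : ∀ g ∈ J, toLocalQuotient L p g = 0) {l : List S} (hl : IsRegularChain J l) :
    IsWeaklyRegular (Localization.AtPrime p) (l.map (toLocalQuotient L p)).reverse := by
  induction l with
  | nil => exact IsWeaklyRegular.nil _ _
  | cons r l ih =>
    rw [List.map_cons, List.reverse_cons, isWeaklyRegular_append_iff]
    refine ⟨ih hl.1, ?_⟩
    rw [isWeaklyRegular_singleton_iff]
    set I := Ideal.ofList (l.map (toLocalQuotient L p)).reverse with hI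
    have hIl : I = (Ideal.ofList l).map (toLocalQuotient L p) := by
      rw [hI, Ideal.map_ofList]
      simp [Ideal.ofList]
    have key : ∀ a, toLocalQuotient L p r * a ∈ I → a ∈ I := by
      intro a ha
      obtain ⟨f, s, hs, hfs⟩ := exists_mul_toLocalQuotient_eq L p a
      have h1 : toLocalQuotient L p (r * f) ∈ (Ideal.ofList l).map (toLocalQuotient L p) := by
        rw [map_mul, ← hfs, ← mul_assoc, ← hIl]
        exact Ideal.mul_mem_right _ _ ha
      obtain ⟨s', hs', hmem⟩ := (toLocalQuotient_mem_map_iff L p).1 h1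
      have h2 : s' * f ∈ J ⊔ Ideal.ofList l := hl.2 _ (by
        rw [mul_left_comm]
        have hle : L ⊔ Ideal.ofList l ≤ J ⊔ Ideal.ofList l := sup_le_sup hLJ le_rfl
        exact hle hmem)
      obtain ⟨j, hj, d, hd, hjd⟩ := Submodule.mem_sup.1 h2
      have h3 : toLocalQuotient L p s' * (a * toLocalQuotient L p s) ∈ I := by
        rw [hfs, ← map_mul, ← hjd, map_add, hJ j hj, zero_add, hIl]
        exact Ideal.mem_map_of_mem _ hd
      have hu := (isUnit_toLocalQuotient_iff L p).2 hs
      have hu' := (isUnit_toLocalQuotient_iff L p).2 hs'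
      rwa [Ideal.unit_mul_mem_iff_mem _ hu', Ideal.mul_unit_mem_iff_mem _ hu] at h3
    refine isSMulRegular_iff_right_eq_zero_of_smul.2 fun x hx => ?_
    obtain ⟨a, rfl⟩ := Submodule.Quotient.mk_surjective _ x
    rw [← Submodule.Quotient.mk_smul, Submodule.Quotient.mk_eq_zero] at hx
    rw [Submodule.Quotient.mk_eq_zero]
    rw [smul_eq_mul, Ideal.mul_top] at hx ⊢
    exact key a hx

end LocalChain

section FullChain
open MvPolynomial

variable {V : Type u} {K : Type u} [Field K]

theorem vars_aeval_X_subset (v : V) (q : Polynomial K) :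
    ((Polynomial.aeval (X v) q : MvPolynomial V K).vars : Set V) ⊆ {v} := by
  rw [← mem_supported, supported, Set.image_singleton]
  exact Polynomial.aeval_mem_adjoin_singleton K _

theorem IsRegularChain.aeval_append {T : Set (MvPolynomial V K)} {θ : List (MvPolynomial V K)}
    (h : IsRegularChain (Ideal.span T) θ) {q : V → Polynomial K} (hq : ∀ v, (q v).Monic)
    {l : List V} (hl : l.Nodup) (hT : ∀ v ∈ l, ∀ t ∈ T, v ∉ t.vars)
    (hθ : ∀ v ∈ l, ∀ t ∈ θ, v ∉ t.vars) :
    IsRegularChain (Ideal.span T) (l.map (fun v => Polynomial.aeval (X v) (q v)) ++ θ) := by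
  induction l with
  | nil => exact h
  | cons v l ih =>
    rw [List.nodup_cons] at hl
    rw [List.forall_mem_cons] at hT hθ
    refine ⟨ih hl.2 hT.2 hθ.2, fun f hf => ?_⟩
    rw [Ideal.ofList, ← Ideal.span_union] at hf ⊢
    refine mem_of_aeval_X_mul_mem ?_ (hq v) hf
    rintro t (ht | ht)
    · exact hT.1 t ht
    rcases List.mem_append.1 ht with ht | ht
    · obtain ⟨v', hv', rfl⟩ := List.mem_map.1 ht
      intro hv
      have := vars_aeval_X_subset v' (q v') hv
      rw [Set.mem_singleton_iff] at this
      exact hl.1 (this ▸ hv')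
    · exact hθ.1 t ht

theorem notMem_vars_of_mem_matchingDifferences {σ : V → V} {U : Set V} {l : List V}
    {t : MvPolynomial V K} (ht : t ∈ matchingDifferences K σ U l) {v : V} (hv : v ∈ U) :
    v ∉ t.vars := by
  classical
  obtain ⟨y, hy, rfl⟩ := List.mem_map.1 ht
  have hy' : y ∉ U ∧ σ y ∉ U := by simpa using (List.mem_filter.1 hy).2
  intro h
  have := vars_sub_subset _ h
  rw [vars_X, vars_X, Finset.mem_union, Finset.mem_singleton, Finset.mem_singleton] at this
  rcases this with rfl | rfl
  exacts [hy'.1 hv, hy'.2 hv]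

theorem IsLeafOrder.ncard_inter_add_length {G : SimpleGraph V} [Finite V] {σ : V → V}
    (hσ : Function.Involutive σ) {U : Set V} (hU : ∀ v, v ∈ U → σ v ∉ U) {l : List V}
    (hl : IsLeafOrder G σ l) :
    (processed σ l ∩ U).ncard + (matchingDifferences K σ U l).length = l.length := by
  induction l with
  | nil => simp [processed, matchingDifferences]
  | cons y l ih =>
    have hy : y ∉ processed σ l ∩ U := fun h => hl.2.1 h.1
    have hσy : σ y ∉ processed σ l ∩ U := fun h =>
      hl.2.1 ((mem_processed_involutive hσ).1 h.1)
    have ih := ih hl.1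
    rw [processed_cons hσ, List.length_cons]
    by_cases h1 : y ∈ U
    · rw [matchingDifferences_cons_of_neg (fun h => h.1 h1), Set.insert_inter_of_mem h1,
        Set.insert_inter_of_notMem (hU y h1), Set.ncard_insert_of_notMem hy]
      omega
    · rw [Set.insert_inter_of_notMem h1]
      by_cases h2 : σ y ∈ U
      · rw [matchingDifferences_cons_of_neg (fun h => h.2 h2), Set.insert_inter_of_mem h2,
          Set.ncard_insert_of_notMem hσy]
        omega
      · rw [matchingDifferences_cons_of_pos ⟨h1, h2⟩, Set.insert_inter_of_notMem h2,
          List.length_cons]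
        omega

end FullChain

section Truncation
open MvPolynomial

variable {V : Type u} {K : Type u} [Field K] {Γ : Set (V →₀ ℕ)} {U : Set V}

open Classical in
/-- The exponents obtained from those in `Γ` by setting the variables in `U` equal to one. -/
noncomputable def truncation (U : Set V) (Γ : Set (V →₀ ℕ)) : Set (V →₀ ℕ) :=
  (Finsupp.filter (· ∉ U)) '' Γ

theorem apply_eq_zero_of_mem_truncation {g : V →₀ ℕ} (hg : g ∈ truncation U Γ) {v : V}
    (hv : v ∈ U) : g v = 0 := by
  classical
  obtain ⟨g, -, rfl⟩ := hg
  exact Finsupp.filter_apply_neg _ _ (not_not.2 hv)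

theorem notMem_vars_monomial_of_mem_truncation {g : V →₀ ℕ} (hg : g ∈ truncation U Γ) {v : V}
    (hv : v ∈ U) : v ∉ (monomial g (1 : K)).vars := by
  rw [vars_monomial one_ne_zero, Finsupp.mem_support_iff, not_not]
  exact apply_eq_zero_of_mem_truncation hg hv

theorem IsSaturatedAt.truncation {x y : V} (h : IsSaturatedAt Γ x y) (hx : x ∉ U) (hy : y ∉ U) :
    IsSaturatedAt (truncation U Γ) x y := by
  classical
  rintro e ⟨_, ⟨g, hg, rfl⟩, hge⟩ ⟨_, ⟨g', hg', rfl⟩, hge'⟩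
  set e' := e.filter (· ∉ U) + (g + g').filter (· ∈ U) with he'
  have key : ∀ {v k}, (k.filter (· ∉ U) : V →₀ ℕ) ≤ e + Finsupp.single v 1 → k ≤ g + g' → v ∉ U →
      k ≤ e' + Finsupp.single v 1 := by
    intro v k hk hkg hv a
    by_cases ha : a ∈ U
    · have := hkg a
      simp only [he', Finsupp.add_apply, Finsupp.filter_apply, ha, not_true_eq_false, if_true,
        if_false] at this ⊢
      omega
    · have := hk a
      simp only [he', Finsupp.add_apply, Finsupp.filter_apply, ha, not_false_eq_true, if_true,
        if_false] at this ⊢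
      omega
  obtain ⟨k, hk, hke⟩ := h e' ⟨g, hg, key hge le_self_add hx⟩
    ⟨g', hg', key hge' le_add_self hy⟩
  refine ⟨_, ⟨k, hk, rfl⟩, fun a => ?_⟩
  have := hke a
  by_cases ha : a ∈ U
  · simp [ha]
  · simpa [he', Finsupp.filter_apply, ha] using this

theorem monomialIdeal_le_truncation (U : Set V) (Γ : Set (V →₀ ℕ)) :
    monomialIdeal K Γ ≤ monomialIdeal K (truncation U Γ) := by
  classical
  rw [monomialIdeal, Ideal.span_le]
  rintro _ ⟨g, hg, rfl⟩
  refine monomial_mem_monomialIdeal_iff.2 ⟨_, ⟨g, hg, rfl⟩, fun a => ?_⟩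
  rw [Finsupp.filter_apply]
  split_ifs
  · exact Nat.zero_le _
  · exact le_rfl

theorem exists_notMem_mul_mem_of_mem_truncation {m : Ideal (MvPolynomial V K)} [m.IsPrime]
    (hU : ∀ v ∈ U, (X v : MvPolynomial V K) ∉ m) {g : V →₀ ℕ} (hg : g ∈ truncation U Γ) :
    ∃ s ∉ m, s * monomial g 1 ∈ monomialIdeal K Γ := by
  classical
  obtain ⟨g, hg, rfl⟩ := hg
  refine ⟨monomial (g.filter (¬ · ∉ U)) 1, ?_, ?_⟩
  · rw [monic_monomial_eq, Finsupp.prod, Ideal.IsPrime.prod_mem_iff]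
    rintro ⟨v, hv, hmem⟩
    rw [Finsupp.support_filter, Finset.mem_filter, not_not] at hv
    exact hU v hv.2 (Ideal.IsPrime.mem_of_pow_mem ‹_› _ hmem)
  · rw [monomial_mul, one_mul, add_comm, Finsupp.filter_add_filter_not]
    exact Ideal.subset_span ⟨g, hg, rfl⟩

theorem edgeExponents_adj {G : SimpleGraph V} {w : Sym2 V → ℕ} {g : V →₀ ℕ}
    (hg : g ∈ truncation U (edgeExponents G w)) {a b : V} (hab : a ≠ b) (ha : g a ≠ 0)
    (hb : g b ≠ 0) : G.Adj a b := by
  classical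
  obtain ⟨_, ⟨u, v, huv, rfl⟩, rfl⟩ := hg
  have key : ∀ c, Finsupp.filter (· ∉ U)
      (Finsupp.single u (w s(u, v)) + Finsupp.single v (w s(u, v))) c ≠ 0 → c = u ∨ c = v := by
    intro c hc
    by_contra! h
    apply hc
    simp [Finsupp.filter_apply, Finsupp.single_eq_of_ne h.1, Finsupp.single_eq_of_ne h.2]
  rcases key a ha with rfl | rfl <;> rcases key b hb with rfl | rfl
  exacts [absurd rfl hab, huv, huv.symm, absurd rfl hab]

end Truncation

section Main
open MvPolynomial IsLocalRing RingTheory.Sequence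

variable {V : Type u} [Fintype V] {K : Type u} [Field K] {G : SimpleGraph V} {w : Sym2 V → ℕ}

theorem exists_isWeaklyRegular_of_isUnmixedIdeal (hG : IsVeryWellCovered G)
    (hw : ∀ e ∈ G.edgeSet, 0 < w e) (hU : IsUnmixedIdeal (weightedEdgeIdeal K G w)) {σ : V → V}
    (hσ : Function.Involutive σ) (hadj : ∀ v, G.Adj v (σ v)) {l : List V}
    (hl : IsLeafOrder G σ l) (hlV : ∀ v, v ∈ processed σ l)
    (p : Ideal (MvPolynomial V K ⧸ weightedEdgeIdeal K G w)) [p.IsMaximal] :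
    ∃ rs : List (Localization.AtPrime p), rs.length = Fintype.card V / 2 ∧
      (∀ r ∈ rs, r ∈ maximalIdeal (Localization.AtPrime p)) ∧
      IsWeaklyRegular (Localization.AtPrime p) rs := by
  set m := preimageIdeal _ p
  set U : Set V := {v | X v ∉ m}
  have hcover : IsVertexCover G {v | X v ∈ m} :=
    isVertexCover_of_weightedEdgeIdeal_le (w := w) (le_preimageIdeal _ p)
  have hUσ : ∀ v, v ∈ U → σ v ∉ U := fun v hv h => (hcover (hadj v)).elim hv h
  set Γ := truncation U (edgeExponents G w)
  have hLΓ : weightedEdgeIdeal K G w ≤ monomialIdeal K Γ := by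
    rw [weightedEdgeIdeal_eq_monomialIdeal]
    exact monomialIdeal_le_truncation U _
  have hker : ∀ g ∈ monomialIdeal K Γ, toLocalQuotient _ p g = 0 := by
    suffices monomialIdeal K Γ ≤ RingHom.ker (toLocalQuotient _ p) from this
    rw [monomialIdeal, Ideal.span_le]
    rintro _ ⟨g, hg, rfl⟩
    rw [SetLike.mem_coe, RingHom.mem_ker, toLocalQuotient_eq_zero_iff]
    obtain ⟨s, hs, hmem⟩ := exists_notMem_mul_mem_of_mem_truncation (m := m) (fun _ hv => hv) hg
    rw [← weightedEdgeIdeal_eq_monomialIdeal] at hmem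
    exact ⟨s, hs, hmem⟩
  obtain ⟨-, -, -, -, -, -, -, -, hchain⟩ := exists_collapse_matchingDifferences (K := K) hσ hadj
    (Γ := Γ) (U := U) (fun v hv hv' => (isSaturatedAt_edgeExponents_of_isUnmixedIdeal hG hw hU
      hσ hadj v).truncation hv hv') (fun g hg a b => edgeExponents_adj hg) hl
  choose q hq hqm using exists_monic_aeval_X_mem m
  have hfull := hchain.aeval_append hq U.toFinite.toFinset.nodup_toList
    (by
      rintro v hv _ ⟨g, hg, rfl⟩
      exact notMem_vars_monomial_of_mem_truncation hg (by simpa using hv))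
    (fun v hv t ht => notMem_vars_of_mem_matchingDifferences ht (by simpa using hv))
  refine ⟨_, ?_, ?_, isWeaklyRegular_of_isRegularChain _ p hLΓ hker hfull⟩
  · have h1 := hl.ncard_inter_add_length (K := K) hσ hUσ
    have h2 := hl.card_processed hσ fun v => (hadj v).ne
    rw [Set.eq_univ_of_forall hlV] at h1 h2
    rw [Set.univ_inter, Set.ncard_eq_toFinset_card U] at h1
    rw [Set.ncard_univ, Nat.card_eq_fintype_card] at h2
    simp only [List.length_reverse, List.length_map, List.length_append, Finset.length_toList]
    omega
  · intro r hr
    obtain ⟨t, ht, rfl⟩ := List.mem_map.1 (List.mem_reverse.1 hr)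
    rw [toLocalQuotient_mem_maximalIdeal_iff]
    rcases List.mem_append.1 ht with ht | ht
    · obtain ⟨v, -, rfl⟩ := List.mem_map.1 ht
      exact hqm v
    · obtain ⟨y, hy, rfl⟩ := List.mem_map.1 ht
      have hy' : y ∉ U ∧ σ y ∉ U := by simpa using (List.mem_filter.1 hy).2
      exact Ideal.sub_mem _ (not_not.1 hy'.1) (not_not.1 hy'.2)

theorem isCohenMacaulayRing_of_isUnmixedIdeal_weightedEdgeIdeal (hG : IsVeryWellCovered G)
    (hCM : IsCohenMacaulayRing (MvPolynomial V K ⧸ edgeIdeal K G))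
    (hw : ∀ e ∈ G.edgeSet, 0 < w e) (hU : IsUnmixedIdeal (weightedEdgeIdeal K G w)) :
    IsCohenMacaulayRing (MvPolynomial V K ⧸ weightedEdgeIdeal K G w) := by
  obtain ⟨σ, hσ, hadj⟩ := hG.exists_matching
  rw [edgeIdeal_eq_weightedEdgeIdeal] at hCM
  obtain ⟨l, hl, hlV⟩ := exists_isLeafOrder hG hσ hadj fun x z hxz hz =>
    hG.not_adj_matching_of_isCohenMacaulayRing (fun _ _ => rfl) hCM hσ hadj hxz hz
  obtain ⟨k, hk⟩ := hG.2.1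
  exact isCohenMacaulayRing_quotient _ (n := Fintype.card V) (h := Fintype.card V / 2)
    (t := Fintype.card V / 2) (fun m hm => (height_of_isMaximal m).le)
    (fun Q _ hQ => le_height_of_weightedEdgeIdeal_le hG hQ) (by omega)
    (fun p _ => exists_isWeaklyRegular_of_isUnmixedIdeal hG hw hU hσ hadj hl hlV p)

end Main

/-- For a Cohen-Macaulay very well-covered graph `G` with an edge weight `w`, the
edge-weighted edge ideal `I(G_w)` is unmixed if and only if `S/I(G_w)` is Cohen-Macaulay. -/
theorem weighted_unmixed_iff_CM_of_veryWellCovered {V : Type u} [Fintype V]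
    (K : Type u) [Field K] (G : SimpleGraph V) (hvwc : IsVeryWellCovered G)
    (hCM : IsCohenMacaulayRing (MvPolynomial V K ⧸ edgeIdeal K G))
    (w : Sym2 V → ℕ) (hw : ∀ e ∈ G.edgeSet, 0 < w e) :
    IsUnmixedIdeal (weightedEdgeIdeal K G w) ↔
      IsCohenMacaulayRing (MvPolynomial V K ⧸ weightedEdgeIdeal K G w) :=
  ⟨isCohenMacaulayRing_of_isUnmixedIdeal_weightedEdgeIdeal hvwc hCM hw,
    isUnmixedIdeal_weightedEdgeIdeal_of_isCohenMacaulayRing hvwc hw⟩
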